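/- (Γ-convergence for unbounded potential energy, Theorem 4.1.) Assume b − a ≤ √(c₁/(4c₂)). Then the functionals 𝔸_{μ_a^{(N)},μ_b^{(N)}} Γ-converge to 𝔸_{μ_a,μ_b} on 𝒫(C([a,b];ℝⁿ)) with respect to weak convergence: (i) whenever π^{(N)} ⇀ π weakly in 𝒫(C([a,b];ℝⁿ)), then liminf_{N→∞} 𝔸_{μ_a^{(N)},μ_b^{(N)}}(π^{(N)}) ≥ 𝔸_{μ_a,μ_b}(π); and (ii) for every π ∈ 𝒫(C([a,b];ℝⁿ)) there exists a sequence π^{(N)} ⇀ π with lim_{N→∞} 𝔸_{μ_a^{(N)},μ_b^{(N)}}(π^{(N)}) = 𝔸_{μ_a,μ_b}(π). -/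

import Mathlib

open MeasureTheory Filter Topology
open scoped ENNReal NNReal

noncomputable section

/-- Euclidean space `ℝⁿ`. -/
abbrev Eu (n : ℕ) := EuclideanSpace ℝ (Fin n)

/-- The space `C([a,b];ℝⁿ)` of continuous curves with the supremum metric. -/
abbrev CPath (a b : ℝ) (n : ℕ) := C(Set.Icc a b, Eu n)

/-- We endow the path space with its Borel σ-algebra. -/
noncomputable instance pathMeasurableSpace (a b : ℝ) (n : ℕ) :
    MeasurableSpace (CPath a b n) := borel _

instance pathBorelSpace (a b : ℝ) (n : ℕ) : BorelSpace (CPath a b n) :=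
  ⟨rfl⟩

/-- Evaluation of a curve at time `t ∈ [a,b]` (junk value `0` outside `[a,b]`). -/
def pev {a b : ℝ} {n : ℕ} (γ : CPath a b n) (t : ℝ) : Eu n :=
  if ht : t ∈ Set.Icc a b then γ ⟨t, ht⟩ else 0

/-- A curve is absolutely continuous if it has a Bochner-integrable derivative `g` with
`γ t = γ s + ∫_s^t g`. -/
def IsACC {a b : ℝ} {n : ℕ} (γ : CPath a b n) : Prop :=
  ∃ g : ℝ → Eu n, IntegrableOn g (Set.Icc a b) ∧
    ∀ s t : Set.Icc a b, γ t = γ s + ∫ u in (s : ℝ)..(t : ℝ), g u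

open Classical in
/-- The action `𝒜(γ) = ∫_a^b L(γ(t), γ̇(t)) dt ∈ (−∞,+∞]`, equal to `+∞` on curves that are
not absolutely continuous (and, by the convention that the integral is `+∞` when the
integrand fails to be integrable -- its negative part being automatically integrable --
also on absolutely continuous curves with non-integrable Lagrangian). -/
def action {n : ℕ} (L : Eu n → Eu n → ℝ) (a b : ℝ) (γ : CPath a b n) : EReal :=
  if h : IsACC γ then
    (if IntegrableOn (fun t => L (pev γ t) (h.choose t)) (Set.Icc a b) then
      (((∫ t in Set.Icc a b, L (pev γ t) (h.choose t)) : ℝ) : EReal)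
    else ⊤)
  else ⊤

/-- Positive part of an extended real, as `ℝ≥0∞`. -/
def epos (x : EReal) : ℝ≥0∞ := if x = ⊤ then ⊤ else ENNReal.ofReal x.toReal

/-- The integral `∫ F dπ ∈ [−∞,+∞]` of an extended-real-valued function, defined as the
difference of the lower integrals of the positive and negative parts. -/
def mint {X : Type*} [MeasurableSpace X] (F : X → EReal) (π : Measure X) : EReal :=
  ((∫⁻ γ, epos (F γ) ∂π : ℝ≥0∞) : EReal) - ((∫⁻ γ, epos (-(F γ)) ∂π : ℝ≥0∞) : EReal)

open Classical in
/-- The constrained functional `𝔸_{μa,μb}(π) = ∫ 𝒜 dπ` if `pr_a#π = μa` and `pr_b#π = μb`,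
and `+∞` otherwise, for a given (extended-real-valued) action functional `F`. -/
def aFun {a b : ℝ} {n : ℕ} (F : CPath a b n → EReal) (μa μb : Measure (Eu n))
    (π : Measure (CPath a b n)) : EReal :=
  if Measure.map (fun γ => pev γ a) π = μa ∧ Measure.map (fun γ => pev γ b) π = μb then
    mint F π
  else ⊤

/-- Weak convergence of a sequence of measures: convergence of the integrals of all bounded
continuous functions. -/
def WeakLim {X : Type*} [TopologicalSpace X] [MeasurableSpace X]
    (πs : ℕ → Measure X) (π : Measure X) : Prop :=
  ∀ φ : BoundedContinuousFunction X ℝ,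
    Tendsto (fun N => ∫ x, φ x ∂(πs N)) atTop (𝓝 (∫ x, φ x ∂π))

/-- The empirical measure `(1/N) ∑_{i=1}^N δ_{x i}`. -/
def emp {X : Type*} [MeasurableSpace X] (N : ℕ) (x : Fin N → X) : Measure X :=
  (N : ℝ≥0∞)⁻¹ • ∑ i : Fin N, Measure.dirac (x i)

/-- The topological support of a measure. -/
def msupp {α : Type*} [TopologicalSpace α] [MeasurableSpace α] (μ : Measure α) : Set α :=
  {x | ∀ U : Set α, IsOpen U → x ∈ U → 0 < μ U}

/-- The set `Γ^min_{K₁,K₂}` of minimizing extremals starting in `K₁` and ending in `K₂`. -/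
def GammaMin {n : ℕ} (L : Eu n → Eu n → ℝ) (a b : ℝ) (K₁ K₂ : Set (Eu n)) :
    Set (CPath a b n) :=
  {γ | IsACC γ ∧ pev γ a ∈ K₁ ∧ pev γ b ∈ K₂ ∧
    ∀ γ' : CPath a b n, IsACC γ' → pev γ' a = pev γ a → pev γ' b = pev γ b →
      action L a b γ ≤ action L a b γ'}

/-- The Lagrangian cost `c(x,y)`: the minimal action among absolutely continuous curves
from `x` to `y`. -/
def cost {n : ℕ} (L : Eu n → Eu n → ℝ) (a b : ℝ) (x y : Eu n) : EReal :=
  ⨅ γ ∈ {γ : CPath a b n | IsACC γ ∧ pev γ a = x ∧ pev γ b = y}, action L a b γ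

/-- The restriction of a continuous curve `ℝ → ℝⁿ` to `[a,b]` as an element of the path
space. -/
def toPath {n : ℕ} (a b : ℝ) (f : ℝ → Eu n) (hf : Continuous f) : CPath a b n :=
  (ContinuousMap.mk f hf).restrict (Set.Icc a b)

/-- `Φ : ℝⁿ × ℝⁿ → C([a,b];ℝⁿ)` is the Euler–Lagrange (Newton) flow map for the Lagrangian
`L(x,v) = (m/2)|v|² − V(x)`: it is continuous and `Φ(x,v)` is a `C²` solution of
`m γ'' = −∇V(γ)` with initial position `x` and initial velocity `v`. -/
def IsNewtonFlow {n : ℕ} (m : ℝ) (V : Eu n → ℝ) (a b : ℝ)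
    (Φ : Eu n × Eu n → CPath a b n) : Prop :=
  Continuous Φ ∧ ∀ x v : Eu n, ∃ f : ℝ → Eu n, ContDiff ℝ 2 f ∧
    (∀ t : Set.Icc a b, Φ (x, v) t = f t) ∧ f a = x ∧ deriv f a = v ∧
    ∀ t ∈ Set.Icc a b, m • deriv (deriv f) t = -gradient V (f t)

/-- The set of `C²` solutions of `m γ'' = −∇V(γ)` starting in `Ka` and ending in `Kb`,
viewed as a subset of the path space. -/
def NewtonSet {n : ℕ} (m : ℝ) (V : Eu n → ℝ) (a b : ℝ) (Ka Kb : Set (Eu n)) :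
    Set (CPath a b n) :=
  {γ | ∃ f : ℝ → Eu n, ContDiff ℝ 2 f ∧ (∀ t : Set.Icc a b, γ t = f t) ∧
    (∀ t ∈ Set.Icc a b, m • deriv (deriv f) t = -gradient V (f t)) ∧
    f a ∈ Ka ∧ f b ∈ Kb}

/-- `γ` is piecewise affine subordinate to the partition `a = τ₀ < … < τ_l = b`. -/
def PiecewiseAffine {n : ℕ} (a b : ℝ) (τ : ℕ → ℝ) (l : ℕ) (γ : CPath a b n) : Prop :=
  ∀ j < l, ∀ t : Set.Icc a b, (t : ℝ) ∈ Set.Icc (τ j) (τ (j + 1)) →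
    γ t = pev γ (τ j) + (((t : ℝ) - τ j) / (τ (j + 1) - τ j)) •
      (pev γ (τ (j + 1)) - pev γ (τ j))

/-- `IsPartition a b τ l h`: `a = τ₀ < τ₁ < … < τ_l = b` is a partition of `[a,b]` of mesh
at most `h`. -/
def IsPartition (a b : ℝ) (τ : ℕ → ℝ) (l : ℕ) (h : ℝ) : Prop :=
  1 ≤ l ∧ τ 0 = a ∧ τ l = b ∧ (∀ j < l, τ j < τ (j + 1)) ∧
    ∀ j < l, τ (j + 1) - τ j ≤ h

/-- The midpoint-rule discrete action, as a (real-valued) sum over the first `l` intervals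
of the partition. -/
def dActionSum {n : ℕ} (m : ℝ) (V : Eu n → ℝ) {a b : ℝ} (τ : ℕ → ℝ) (l : ℕ)
    (γ : CPath a b n) : ℝ :=
  ∑ j ∈ Finset.range l,
    (m / 2 * ‖pev γ (τ (j + 1)) - pev γ (τ j)‖ ^ 2 / (τ (j + 1) - τ j) -
      V ((2 : ℝ)⁻¹ • (pev γ (τ (j + 1)) + pev γ (τ j))) * (τ (j + 1) - τ j))

open Classical in
/-- The discrete action `𝒜^{[h]}`: the midpoint-rule discrete action for piecewise affine
curves subordinate to the partition, `+∞` otherwise. -/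
def dAction {n : ℕ} (m : ℝ) (V : Eu n → ℝ) (a b : ℝ) (τ : ℕ → ℝ) (l : ℕ)
    (γ : CPath a b n) : EReal :=
  if PiecewiseAffine a b τ l γ then ((dActionSum m V τ l γ : ℝ) : EReal) else ⊤

/-- The discrete Euler–Lagrange equations for a piecewise affine curve subordinate to the
partition `a = τ₀ < … < τ_l = b`. -/
def DiscreteEL {n : ℕ} (m : ℝ) (V : Eu n → ℝ) {a b : ℝ} (τ : ℕ → ℝ) (l : ℕ)
    (γ : CPath a b n) : Prop :=
  ∀ j, 1 ≤ j → j < l →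
    m • ((τ j - τ (j - 1))⁻¹ • (pev γ (τ j) - pev γ (τ (j - 1)))) -
      m • ((τ (j + 1) - τ j)⁻¹ • (pev γ (τ (j + 1)) - pev γ (τ j))) =
    ((τ j - τ (j - 1)) / 2) • gradient V ((2 : ℝ)⁻¹ • (pev γ (τ (j - 1)) + pev γ (τ j))) +
      ((τ (j + 1) - τ j) / 2) • gradient V ((2 : ℝ)⁻¹ • (pev γ (τ j) + pev γ (τ (j + 1))))

end
section

variable {n : ℕ} {a b : ℝ} {L : Eu n → Eu n → ℝ} {c₁ c₂ : ℝ} {x₀ : Eu n}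

/-- `g` is an integrable derivative of the curve `γ`. -/
structure IsDer (γ : CPath a b n) (g : ℝ → Eu n) : Prop where
  integrableOn : IntegrableOn g (Set.Icc a b)
  eq_add : ∀ t ∈ Set.Icc a b, pev γ t = pev γ a + ∫ u in a..t, g u

theorem pev_of_mem {γ : CPath a b n} {t : ℝ} (ht : t ∈ Set.Icc a b) : pev γ t = γ ⟨t, ht⟩ :=
  dif_pos ht

theorem pev_add (γ η : CPath a b n) (t : ℝ) : pev (γ + η) t = pev γ t + pev η t := by
  unfold pev; split_ifs <;> simp

theorem continuousOn_pev (γ : CPath a b n) : ContinuousOn (pev γ) (Set.Icc a b) := by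
  rw [continuousOn_iff_continuous_domRestrict]
  have : (Set.Icc a b).domRestrict (pev γ) = γ := by
    ext1 t
    exact pev_of_mem t.2
  rw [this]
  exact γ.continuous

theorem norm_pev_sub_le (γ η : CPath a b n) (t : ℝ) : ‖pev γ t - pev η t‖ ≤ dist γ η := by
  unfold pev; split_ifs with h
  · rw [← dist_eq_norm]; exact ContinuousMap.dist_apply_le_dist _
  · simp

theorem continuous_pev_left (t : ℝ) : Continuous fun γ : CPath a b n => pev γ t := by
  unfold pev
  split_ifs with h
  · exact continuous_eval_const _
  · exact continuous_const

theorem MeasureTheory.IntegrableOn.intervalIntegrable_of_mem_Icc {E : Type*} [NormedAddCommGroup E] {g : ℝ → E}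
    (hg : IntegrableOn g (Set.Icc a b)) {s t : ℝ} (hs : s ∈ Set.Icc a b) (ht : t ∈ Set.Icc a b) :
    IntervalIntegrable g volume s t := by
  refine (hg.mono_set ?_).intervalIntegrable
  exact Set.uIcc_subset_Icc hs ht

theorem isACC_iff_exists_isDer (hab : a < b) {γ : CPath a b n} : IsACC γ ↔ ∃ g, IsDer γ g := by
  have ha : a ∈ Set.Icc a b := ⟨le_rfl, hab.le⟩
  constructor
  · rintro ⟨g, hg, h⟩
    refine ⟨g, hg, fun t ht => ?_⟩
    rw [pev_of_mem ht, pev_of_mem ha]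
    exact h ⟨a, ha⟩ ⟨t, ht⟩
  · rintro ⟨g, hg, h⟩
    refine ⟨g, hg, fun s t => ?_⟩
    have h1 := h s s.2
    have h2 := h t t.2
    rw [pev_of_mem s.2] at h1
    rw [pev_of_mem t.2] at h2
    rw [h1, h2, add_assoc, intervalIntegral.integral_add_adjacent_intervals]
    · exact hg.intervalIntegrable_of_mem_Icc ha s.2
    · exact hg.intervalIntegrable_of_mem_Icc s.2 t.2

theorem IsDer.ae_eq (hab : a < b) {γ : CPath a b n} {g g' : ℝ → Eu n} (h : IsDer γ g)
    (h' : IsDer γ g') : g =ᵐ[volume.restrict (Set.Icc a b)] g' := by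
  have ha : a ∈ Set.Icc a b := ⟨le_rfl, hab.le⟩
  have hb : b ∈ Set.Icc a b := ⟨hab.le, le_rfl⟩
  have e1 := (h.integrableOn.intervalIntegrable_of_mem_Icc ha hb).ae_hasDerivAt_integral
  have e2 := (h'.integrableOn.intervalIntegrable_of_mem_Icc ha hb).ae_hasDerivAt_integral
  have n1 : ∀ᵐ x : ℝ, x ≠ a := by simp [ae_iff, measure_singleton]
  have n2 : ∀ᵐ x : ℝ, x ≠ b := by simp [ae_iff, measure_singleton]
  rw [Filter.EventuallyEq, ae_restrict_iff' measurableSet_Icc]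
  filter_upwards [e1, e2, n1, n2] with x h1 h2 hxa hxb hx
  rw [Set.uIcc_of_le hab.le] at h1 h2
  have d1 := h1 hx a ha
  have d2 := h2 hx a ha
  refine d1.unique (d2.congr_of_eventuallyEq ?_)
  filter_upwards [Icc_mem_nhds (lt_of_le_of_ne hx.1 (Ne.symm hxa))
    (lt_of_le_of_ne hx.2 hxb)] with t ht
  have := (h.eq_add t ht).symm.trans (h'.eq_add t ht)
  exact add_left_cancel this

open Classical in
theorem IsDer.action_eq (hab : a < b) {L : Eu n → Eu n → ℝ} {γ : CPath a b n} {g : ℝ → Eu n}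
    (h : IsDer γ g) : action L a b γ =
      if IntegrableOn (fun t => L (pev γ t) (g t)) (Set.Icc a b) then
        ((∫ t in Set.Icc a b, L (pev γ t) (g t) : ℝ) : EReal) else ⊤ := by
  have hA : IsACC γ := (isACC_iff_exists_isDer hab).2 ⟨g, h⟩
  have ha : a ∈ Set.Icc a b := ⟨le_rfl, hab.le⟩
  have hc : IsDer γ hA.choose := by
    refine ⟨hA.choose_spec.1, fun t ht => ?_⟩
    rw [pev_of_mem ht, pev_of_mem ha]
    exact hA.choose_spec.2 ⟨a, ha⟩ ⟨t, ht⟩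
  have hae : (fun t => L (pev γ t) (hA.choose t)) =ᵐ[volume.restrict (Set.Icc a b)]
      fun t => L (pev γ t) (g t) := by
    filter_upwards [hc.ae_eq hab h] with t ht
    rw [ht]
  rw [action, dif_pos hA, integral_congr_ae hae, IntegrableOn, integrable_congr hae, ← IntegrableOn]

theorem IsDer.action_eq_integral (hab : a < b) {L : Eu n → Eu n → ℝ} {γ : CPath a b n}
    {g : ℝ → Eu n} (h : IsDer γ g)
    (hi : IntegrableOn (fun t => L (pev γ t) (g t)) (Set.Icc a b)) :
    action L a b γ = ((∫ t in Set.Icc a b, L (pev γ t) (g t) : ℝ) : EReal) := by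
  rw [h.action_eq hab, if_pos hi]

theorem exists_isDer_of_action_ne_top (hab : a < b) {L : Eu n → Eu n → ℝ} {γ : CPath a b n}
    (h : action L a b γ ≠ ⊤) :
    ∃ g, IsDer γ g ∧ IntegrableOn (fun t => L (pev γ t) (g t)) (Set.Icc a b) := by
  by_cases hA : IsACC γ
  · obtain ⟨g, hg⟩ := (isACC_iff_exists_isDer hab).1 hA
    refine ⟨g, hg, ?_⟩
    by_contra hi
    rw [hg.action_eq hab, if_neg hi] at h
    exact h rfl
  · rw [action, dif_neg hA] at h
    exact absurd rfl h

/-- A Lagrangian that lies above its tangents in the velocity and has quadratic lower growth. -/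
structure IsTonelli (L : Eu n → Eu n → ℝ) (c₁ c₂ : ℝ) (x₀ : Eu n) : Prop where
  contDiff : ContDiff ℝ 1 (Function.uncurry L)
  tangent : ∀ x v w, L x w + fderiv ℝ (Function.uncurry L) (x, w) (0, v - w) ≤ L x v
  pos₁ : 0 < c₁
  pos₂ : 0 < c₂
  growth : ∀ x v, c₁ * ‖v‖ ^ 2 - c₂ * (1 + ‖x - x₀‖ ^ 2) ≤ L x v

theorem isTonelli_of_hessian_pos {L : Eu n → Eu n → ℝ}
    (hL1 : ContDiff ℝ (⊤ : ℕ∞) (Function.uncurry L))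
    {c₀ : ℝ} (hc₀ : 0 < c₀)
    (hL2 : ∀ x v w : Eu n, c₀ * ‖w‖ ^ 2 ≤ fderiv ℝ (fderiv ℝ (L x)) v w w)
    {c₁ c₂ : ℝ} (hc₁ : 0 < c₁) (hc₂ : 0 < c₂) {x₀ : Eu n}
    (hL3 : ∀ x v : Eu n, c₁ * ‖v‖ ^ 2 - c₂ * (1 + ‖x - x₀‖ ^ 2) ≤ L x v) :
    IsTonelli L c₁ c₂ x₀ := by
  refine ⟨hL1.of_le (by exact_mod_cast le_top), fun x v w => ?_, hc₁, hc₂, hL3⟩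
  have hx : ContDiff ℝ 2 (L x) :=
    (hL1.comp (contDiff_prodMk_right x)).of_le (WithTop.coe_le_coe.2 (le_top : (2 : ℕ∞) ≤ ⊤))
  have hd1 : Differentiable ℝ (L x) := hx.differentiable (by norm_num)
  have hx1 : ContDiff ℝ 1 (fderiv ℝ (L x)) := hx.fderiv_right (by norm_num)
  have hd2 : Differentiable ℝ (fderiv ℝ (L x)) := hx1.differentiable (by norm_num)
  set z := v - w with hz
  have hl : ∀ s : ℝ, HasDerivAt (fun s : ℝ => w + s • z) z s := fun s => by
    simpa using ((hasDerivAt_id s).smul_const z).const_add w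
  have hg : ∀ s : ℝ, HasDerivAt (fun s : ℝ => L x (w + s • z)) (fderiv ℝ (L x) (w + s • z) z) s :=
    fun s => (hd1 _).hasFDerivAt.comp_hasDerivAt s (hl s)
  have hg' : ∀ s : ℝ, HasDerivAt (fun s : ℝ => fderiv ℝ (L x) (w + s • z) z)
      (fderiv ℝ (fderiv ℝ (L x)) (w + s • z) z z) s := fun s => by
    exact (ContinuousLinearMap.apply ℝ ℝ z).hasFDerivAt.comp_hasDerivAt s
      ((hd2 (w + s • z)).hasFDerivAt.comp_hasDerivAt s (hl s))
  have hmono : Monotone fun s : ℝ => fderiv ℝ (L x) (w + s • z) z := by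
    refine monotone_of_deriv_nonneg (fun s => (hg' s).differentiableAt) fun s => ?_
    rw [(hg' s).deriv]
    exact le_trans (by positivity) (hL2 x _ z)
  obtain ⟨ξ, hξ, h⟩ := exists_hasDerivAt_eq_slope (fun s : ℝ => L x (w + s • z)) _ zero_lt_one
    (fun s _ => (hg s).continuousAt.continuousWithinAt) (fun s _ => hg s)
  have h0 : fderiv ℝ (L x) (w + (0 : ℝ) • z) z ≤ fderiv ℝ (L x) (w + ξ • z) z := hmono hξ.1.le
  have hcomp : fderiv ℝ (L x) w z = fderiv ℝ (Function.uncurry L) (x, w) (0, z) := by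
    have h1 : HasFDerivAt (Function.uncurry L) (fderiv ℝ (Function.uncurry L) (x, w)) (x, w) :=
      (hL1.differentiable (by simp) _).hasFDerivAt
    have h2 := h1.comp w (hasFDerivAt_prodMk_right x w)
    have h3 : fderiv ℝ (L x) w = _ := h2.fderiv
    rw [h3]
    simp
  simp only [zero_smul, add_zero, one_smul, sub_zero, div_one] at h h0
  rw [h, hcomp] at h0
  have : w + z = v := by simp [hz]
  rw [this] at h0
  linarith

theorem IsTonelli.continuous (hL : IsTonelli L c₁ c₂ x₀) : Continuous (Function.uncurry L) :=
  hL.contDiff.continuous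

theorem IsTonelli.mul_inv_smul_le (hL : IsTonelli L c₁ c₂ x₀) (x v : Eu n) {r : ℝ} (hr : 1 ≤ r) :
    r * L x (r⁻¹ • v) ≤ L x v + (r - 1) * L x 0 := by
  have hr0 : r ≠ 0 := by positivity
  have h1 := hL.tangent x v (r⁻¹ • v)
  have h2 := hL.tangent x 0 (r⁻¹ • v)
  have e1 : ((0 : Eu n), v - r⁻¹ • v) = (r - 1) • ((0 : Eu n), r⁻¹ • v) := by
    ext1
    · simp
    · simp [smul_smul, mul_inv_cancel₀ hr0, sub_smul]
  have e2 : ((0 : Eu n), 0 - r⁻¹ • v) = -((0 : Eu n), r⁻¹ • v) := by simp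
  rw [e1, map_smul, smul_eq_mul] at h1
  rw [e2, map_neg] at h2
  nlinarith

theorem IsTonelli.aestronglyMeasurable (hL : IsTonelli L c₁ c₂ x₀) {γ : CPath a b n}
    {g : ℝ → Eu n} (hg : AEStronglyMeasurable g (volume.restrict (Set.Icc a b))) :
    AEStronglyMeasurable (fun t => L (pev γ t) (g t)) (volume.restrict (Set.Icc a b)) :=
  hL.continuous.comp_aestronglyMeasurable
    (((continuousOn_pev γ).aestronglyMeasurable measurableSet_Icc).prodMk hg)

theorem action_ne_bot {γ : CPath a b n} : action L a b γ ≠ ⊥ := by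
  unfold action
  split_ifs
  · exact EReal.coe_ne_bot _
  · simp
  · simp

theorem exists_norm_pev_le (γ : CPath a b n) : ∃ R, 0 ≤ R ∧ ∀ t, ‖pev γ t‖ ≤ R := by
  refine ⟨‖γ‖, norm_nonneg _, fun t => ?_⟩
  unfold pev; split_ifs
  · exact ContinuousMap.norm_coe_le_norm _ _
  · simp

theorem IsDer.aestronglyMeasurable {γ : CPath a b n} {g : ℝ → Eu n} (h : IsDer γ g) :
    AEStronglyMeasurable g (volume.restrict (Set.Icc a b)) :=
  h.integrableOn.aestronglyMeasurable

theorem integral_Icc_const (hab : a < b) (c : ℝ) : ∫ _ in Set.Icc a b, c = (b - a) * c := by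
  simp [hab.le]

theorem IsTonelli.integrableOn_sq (hL : IsTonelli L c₁ c₂ x₀) {γ : CPath a b n}
    {g : ℝ → Eu n} (h : IsDer γ g)
    (hi : IntegrableOn (fun t => L (pev γ t) (g t)) (Set.Icc a b)) :
    IntegrableOn (fun t => ‖g t‖ ^ 2) (Set.Icc a b) := by
  obtain ⟨R, hR0, hR⟩ := exists_norm_pev_le γ
  have hR' : ∀ t, ‖pev γ t - x₀‖ ≤ R + ‖x₀‖ := fun t => (norm_sub_le _ _).trans (by gcongr; exact hR t)
  have h1 : IntegrableOn (fun t => c₁⁻¹ * (L (pev γ t) (g t) + c₂ * (1 + (R + ‖x₀‖) ^ 2)))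
      (Set.Icc a b) := (hi.add (integrable_const _)).const_mul _
  refine h1.mono' (h.aestronglyMeasurable.norm.pow 2) (ae_of_all _ fun t => ?_)
  rw [Real.norm_of_nonneg (by positivity), le_inv_mul_iff₀ hL.pos₁]
  have := hL.growth (pev γ t) (g t)
  have h2 : ‖pev γ t - x₀‖ ^ 2 ≤ (R + ‖x₀‖) ^ 2 := by gcongr; exact hR' t
  nlinarith [hL.pos₂]

theorem IsTonelli.integral_sq_le (hL : IsTonelli L c₁ c₂ x₀) (hab : a < b) {γ : CPath a b n}
    {g : ℝ → Eu n} (h : IsDer γ g)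
    (hi : IntegrableOn (fun t => L (pev γ t) (g t)) (Set.Icc a b)) {S : ℝ}
    (hS : ∀ t ∈ Set.Icc a b, ‖pev γ t - x₀‖ ^ 2 ≤ S) :
    c₁ * ∫ t in Set.Icc a b, ‖g t‖ ^ 2 ≤
      (∫ t in Set.Icc a b, L (pev γ t) (g t)) + (b - a) * (c₂ * (1 + S)) := by
  rw [← integral_const_mul, ← integral_Icc_const hab, ← integral_add hi (integrable_const _)]
  refine setIntegral_mono_on ((hL.integrableOn_sq h hi).const_mul _) (hi.add (integrable_const _))
    measurableSet_Icc fun t ht => ?_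
  have := hL.growth (pev γ t) (g t)
  have h2 := hS t ht
  nlinarith [hL.pos₂]

theorem IsDer.norm_sub_le {γ : CPath a b n} {g : ℝ → Eu n} (h : IsDer γ g) {t : ℝ}
    (ht : t ∈ Set.Icc a b) : ‖pev γ t - pev γ a‖ ≤ ∫ t in Set.Icc a b, ‖g t‖ := by
  rw [h.eq_add t ht, add_sub_cancel_left]
  refine (intervalIntegral.norm_integral_le_integral_norm ht.1).trans ?_
  rw [intervalIntegral.integral_of_le ht.1]
  refine setIntegral_mono_set h.integrableOn.norm (ae_of_all _ fun _ => norm_nonneg _) ?_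
  exact LE.le.eventuallyLE fun s hs => ⟨hs.1.le, hs.2.trans ht.2⟩

theorem sq_integral_norm_le (hab : a < b) {g : ℝ → Eu n} (hg : IntegrableOn g (Set.Icc a b))
    (hg2 : IntegrableOn (fun t => ‖g t‖ ^ 2) (Set.Icc a b)) :
    (∫ t in Set.Icc a b, ‖g t‖) ^ 2 ≤ (b - a) * ∫ t in Set.Icc a b, ‖g t‖ ^ 2 := by
  have hba : 0 < b - a := sub_pos.2 hab
  set I := ∫ t in Set.Icc a b, ‖g t‖
  set D := ∫ t in Set.Icc a b, ‖g t‖ ^ 2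
  have key : 2 * (I / (b - a)) * I ≤ (b - a) * (I / (b - a)) ^ 2 + D := by
    rw [← integral_Icc_const hab, ← integral_const_mul, ← integral_add (integrable_const _) hg2]
    refine setIntegral_mono_on (hg.norm.const_mul _) ((integrable_const _).add hg2)
      measurableSet_Icc fun t _ => ?_
    nlinarith [sq_nonneg (I / (b - a) - ‖g t‖)]
  have e : (b - a) * (2 * (I / (b - a)) * I - (b - a) * (I / (b - a)) ^ 2) = I ^ 2 := by
    field_simp; ring
  nlinarith

theorem IsTonelli.le_action (hL : IsTonelli L c₁ c₂ x₀) (hab : a < b)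
    (htime : b - a ≤ Real.sqrt (c₁ / (4 * c₂))) {γ : CPath a b n} {R : ℝ}
    (hR : ‖pev γ a - x₀‖ ≤ R) :
    ((-((b - a) * (c₂ * (1 + 2 * R ^ 2))) : ℝ) : EReal) ≤ action L a b γ := by
  by_cases hA : action L a b γ = ⊤
  · rw [hA]; exact le_top
  obtain ⟨g, hg, hi⟩ := exists_isDer_of_action_ne_top hab hA
  rw [hg.action_eq_integral hab hi, EReal.coe_le_coe_iff]
  have hc1 := hL.pos₁
  have hc2 := hL.pos₂
  have hba : 0 < b - a := sub_pos.2 hab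
  have ht2 : (b - a) ^ 2 ≤ c₁ / (4 * c₂) := by
    rw [← Real.sq_sqrt (show 0 ≤ c₁ / (4 * c₂) by positivity)]
    gcongr
  rw [le_div_iff₀ (by positivity)] at ht2
  have hI := sq_integral_norm_le hab hg.integrableOn (hL.integrableOn_sq hg hi)
  have hI0 : 0 ≤ ∫ t in Set.Icc a b, ‖g t‖ := integral_nonneg fun _ => norm_nonneg _
  have hD0 : 0 ≤ ∫ t in Set.Icc a b, ‖g t‖ ^ 2 := integral_nonneg fun _ => by positivity
  have hS : ∀ t ∈ Set.Icc a b, ‖pev γ t - x₀‖ ^ 2 ≤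
      2 * R ^ 2 + 2 * ((b - a) * ∫ t in Set.Icc a b, ‖g t‖ ^ 2) := fun t ht => by
    have h1 : ‖pev γ t - x₀‖ ≤ (∫ t in Set.Icc a b, ‖g t‖) + R := by
      rw [← sub_add_sub_cancel]
      exact (norm_add_le _ _).trans (add_le_add (hg.norm_sub_le ht) hR)
    have h2 : ‖pev γ t - x₀‖ ^ 2 ≤ ((∫ t in Set.Icc a b, ‖g t‖) + R) ^ 2 := by gcongr
    nlinarith [sq_nonneg ((∫ t in Set.Icc a b, ‖g t‖) - R)]
  have := hL.integral_sq_le hab hg hi hS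
  nlinarith

theorem exists_weak_limit {H : Type*} [NormedAddCommGroup H] [InnerProductSpace ℝ H]
    [CompleteSpace H] {u : ℕ → H} {B : ℝ} (hB : ∀ k, ‖u k‖ ≤ B) (𝒰 : Ultrafilter ℕ) :
    ∃ w : H, ∀ e : H, Tendsto (fun k => inner ℝ e (u k)) 𝒰 (𝓝 (inner ℝ e w)) := by
  have hc := WeakDual.isCompact_closedBall (𝕜 := ℝ) (0 : StrongDual ℝ H) B
  let φ : ℕ → WeakDual ℝ H := fun k => StrongDual.toWeakDual (InnerProductSpace.toDual ℝ H (u k))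
  obtain ⟨ℓ, -, hℓ⟩ := hc.ultrafilter_le_nhds (𝒰.map φ) (by
    rw [le_principal_iff]
    change ∀ᶠ k in (𝒰 : Filter ℕ), φ k ∈ _
    refine Filter.Eventually.of_forall fun k => ?_
    simpa [φ] using hB k)
  refine ⟨(InnerProductSpace.toDual ℝ H).symm (WeakDual.toStrongDual ℓ), fun e => ?_⟩
  have h1 : Tendsto φ 𝒰 (𝓝 ℓ) := hℓ
  have h2 := ((WeakDual.eval_continuous e).tendsto ℓ).comp h1
  rw [real_inner_comm, InnerProductSpace.toDual_symm_apply]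
  refine h2.congr fun k => ?_
  rw [real_inner_comm]
  exact InnerProductSpace.toDual_apply_apply (𝕜 := ℝ)

section L2
variable {α : Type*} [MeasurableSpace α] {μ : Measure α}
  {E : Type*} [NormedAddCommGroup E] [InnerProductSpace ℝ E]

theorem inner_toLp_toLp {f g : α → E} (hf : MemLp f 2 μ) (hg : MemLp g 2 μ) :
    inner ℝ (hf.toLp f) (hg.toLp g) = ∫ t, inner ℝ (f t) (g t) ∂μ := by
  rw [L2.inner_def]
  refine integral_congr_ae ?_
  filter_upwards [hf.coeFn_toLp, hg.coeFn_toLp] with t h1 h2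
  rw [h1, h2]

theorem norm_toLp_sq {f : α → E} (hf : MemLp f 2 μ) : ‖hf.toLp f‖ ^ 2 = ∫ t, ‖f t‖ ^ 2 ∂μ := by
  rw [← real_inner_self_eq_norm_sq, inner_toLp_toLp]
  simp_rw [real_inner_self_eq_norm_sq]

theorem exists_weak_limit_memLp [CompleteSpace E] {g : ℕ → α → E} (hg : ∀ k, MemLp (g k) 2 μ)
    {B : ℝ} (hB : ∀ k, ∫ t, ‖g k t‖ ^ 2 ∂μ ≤ B) (𝒰 : Ultrafilter ℕ) :
    ∃ w : α → E, StronglyMeasurable w ∧ MemLp w 2 μ ∧ ∀ e : α → E, MemLp e 2 μ →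
      Tendsto (fun k => ∫ t, inner ℝ (e t) (g k t) ∂μ) 𝒰 (𝓝 (∫ t, inner ℝ (e t) (w t) ∂μ)) := by
  obtain ⟨w, hw⟩ := exists_weak_limit (u := fun k => (hg k).toLp (g k)) (B := Real.sqrt B)
    (fun k => by
      refine Real.le_sqrt_of_sq_le ?_
      rw [norm_toLp_sq]
      exact hB k) 𝒰
  refine ⟨w, Lp.stronglyMeasurable w, Lp.memLp w, fun e he => ?_⟩
  have := hw (he.toLp e)
  simp_rw [inner_toLp_toLp] at this
  conv at this =>
    rhs
    rw [← Lp.toLp_coeFn w (Lp.memLp w), inner_toLp_toLp]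
  exact this

theorem tendsto_integral_inner_zero {ι : Type*} {l : Filter ι} {g Δ : ι → α → E}
    (hg : ∀ k, MemLp (g k) 2 μ) {B : ℝ} (hB : ∀ k, ∫ t, ‖g k t‖ ^ 2 ∂μ ≤ B)
    (hΔ : ∀ᶠ k in l, MemLp (Δ k) 2 μ)
    (hΔ0 : Tendsto (fun k => ∫ t, ‖Δ k t‖ ^ 2 ∂μ) l (𝓝 0)) :
    Tendsto (fun k => ∫ t, inner ℝ (Δ k t) (g k t) ∂μ) l (𝓝 0) := by
  have h1 : Tendsto (fun k => Real.sqrt (∫ t, ‖Δ k t‖ ^ 2 ∂μ) * Real.sqrt B) l (𝓝 0) := by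
    have := (hΔ0.sqrt).mul_const (Real.sqrt B)
    simpa using this
  refine squeeze_zero_norm' ?_ h1
  filter_upwards [hΔ] with k hk
  rw [← inner_toLp_toLp hk (hg k)]
  refine (norm_inner_le_norm _ _).trans ?_
  gcongr
  · refine Real.le_sqrt_of_sq_le ?_
    rw [norm_toLp_sq]
  · refine Real.le_sqrt_of_sq_le ?_
    rw [norm_toLp_sq]
    exact hB k

theorem integrable_and_integral_le_of_tendsto {f : ℕ → α → ℝ} {F G : α → ℝ} {c : ℝ}
    (hf : ∀ m, Integrable (f m) μ) (hG : Integrable G μ) (hFG : ∀ m t, -G t ≤ f m t)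
    (hlim : ∀ t, Tendsto (fun m => f m t) atTop (𝓝 (F t)))
    (hF : AEStronglyMeasurable F μ) (hc : ∀ m, ∫ t, f m t ∂μ ≤ c) :
    Integrable F μ ∧ ∫ t, F t ∂μ ≤ c := by
  have hFG0 : ∀ t, 0 ≤ F t + G t := fun t => by
    have := ge_of_tendsto' (hlim t) (fun m => hFG m t)
    linarith
  have key : ∫⁻ t, ENNReal.ofReal (F t + G t) ∂μ ≤ ENNReal.ofReal (c + ∫ t, G t ∂μ) := by
    calc ∫⁻ t, ENNReal.ofReal (F t + G t) ∂μ
        = ∫⁻ t, liminf (fun m => ENNReal.ofReal (f m t + G t)) atTop ∂μ := by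
          refine lintegral_congr fun t => ?_
          exact (((ENNReal.continuous_ofReal.tendsto _).comp
            ((hlim t).add_const (G t))).liminf_eq).symm
      _ ≤ liminf (fun m => ∫⁻ t, ENNReal.ofReal (f m t + G t) ∂μ) atTop :=
          lintegral_liminf_le' fun m => ((hf m).add hG).aemeasurable.ennreal_ofReal
      _ ≤ ENNReal.ofReal (c + ∫ t, G t ∂μ) := by
          refine liminf_le_of_le (by isBoundedDefault) fun x hx => ?_
          obtain ⟨m, hm⟩ := hx.exists
          refine hm.trans ?_
          have hi : Integrable (fun t => f m t + G t) μ := (hf m).add hG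
          rw [← ofReal_integral_eq_lintegral_ofReal hi
            (ae_of_all _ fun t => by have := hFG m t; simp only [Pi.zero_apply]; linarith)]
          refine ENNReal.ofReal_le_ofReal ?_
          rw [integral_add (hf m) hG]
          linarith [hc m]
  have hi : Integrable (fun t => F t + G t) μ := by
    refine ⟨hF.add hG.aestronglyMeasurable, ?_⟩
    rw [hasFiniteIntegral_iff_ofReal (ae_of_all _ hFG0)]
    exact key.trans_lt ENNReal.ofReal_lt_top
  have hFi : Integrable F μ := (hi.sub hG).congr (ae_of_all _ fun t => by simp)
  refine ⟨hFi, ?_⟩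
  rw [← ofReal_integral_eq_lintegral_ofReal hi (ae_of_all _ hFG0), integral_add hFi hG] at key
  have h0 : 0 ≤ c + ∫ t, G t ∂μ := by
    have : 0 ≤ ∫ t, (f 0 t + G t) ∂μ := integral_nonneg fun t => by
      have := hFG 0 t; simp only [Pi.zero_apply]; linarith
    rw [integral_add (hf 0) hG] at this
    linarith [hc 0]
  rw [ENNReal.ofReal_le_ofReal_iff h0] at key
  linarith

end L2

/-- The gradient of the Lagrangian with respect to the velocity. -/
noncomputable def velGrad (L : Eu n → Eu n → ℝ) (p : Eu n × Eu n) : Eu n :=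
  (InnerProductSpace.toDual ℝ (Eu n)).symm
    ((fderiv ℝ (Function.uncurry L) p).comp (ContinuousLinearMap.inr ℝ (Eu n) (Eu n)))

theorem inner_velGrad (x v z : Eu n) :
    inner ℝ (velGrad L (x, v)) z = fderiv ℝ (Function.uncurry L) (x, v) (0, z) := by
  simp [velGrad]

theorem IsTonelli.continuous_velGrad (hL : IsTonelli L c₁ c₂ x₀) : Continuous (velGrad L) := by
  have h := hL.contDiff.continuous_fderiv (by norm_num)
  exact (InnerProductSpace.toDual ℝ (Eu n)).symm.continuous.comp (h.clm_comp continuous_const)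

theorem IsTonelli.tangent_velGrad (hL : IsTonelli L c₁ c₂ x₀) (x v w : Eu n) :
    L x w + inner ℝ (velGrad L (x, w)) v - inner ℝ (velGrad L (x, w)) w ≤ L x v := by
  have := hL.tangent x v w
  rw [← inner_velGrad, inner_sub_right] at this
  linarith

/-- A continuous function is bounded along curves near `γ` paired with a bounded function. -/
theorem exists_forall_norm_comp_le {E : Type*} [NormedAddCommGroup E] {F : Eu n × Eu n → E}
    (hF : Continuous F) (γ : CPath a b n) (m : ℝ) :
    ∃ C, 0 ≤ C ∧ ∀ η : CPath a b n, dist η γ ≤ 1 → ∀ t v, ‖v‖ ≤ m → ‖F (pev η t, v)‖ ≤ C := by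
  obtain ⟨R, hR0, hR⟩ := exists_norm_pev_le γ
  obtain ⟨C, hC⟩ := ((isCompact_closedBall (0 : Eu n) (R + 1)).prod
    (isCompact_closedBall (0 : Eu n) m)).exists_bound_of_continuousOn hF.continuousOn
  refine ⟨max C 0, le_max_right _ _, fun η hη t v hv => (hC _ ⟨?_, ?_⟩).trans (le_max_left _ _)⟩
  · rw [mem_closedBall_zero_iff]
    have h1 := norm_pev_sub_le η γ t
    calc ‖pev η t‖ = ‖pev γ t + (pev η t - pev γ t)‖ := by rw [add_sub_cancel]
      _ ≤ R + 1 := (norm_add_le _ _).trans (add_le_add (hR t) (h1.trans hη))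
  · simpa using hv

theorem aestronglyMeasurable_comp_pev {E : Type*} [NormedAddCommGroup E] {F : Eu n × Eu n → E}
    (hF : Continuous F) (γ : CPath a b n) {w : ℝ → Eu n} (hw : StronglyMeasurable w) :
    AEStronglyMeasurable (fun t => F (pev γ t, w t)) (volume.restrict (Set.Icc a b)) :=
  hF.comp_aestronglyMeasurable
    (((continuousOn_pev γ).aestronglyMeasurable measurableSet_Icc).prodMk hw.aestronglyMeasurable)

theorem memLp_comp_pev {E : Type*} [NormedAddCommGroup E] {F : Eu n × Eu n → E}
    (hF : Continuous F) (γ : CPath a b n) {w : ℝ → Eu n} (hw : StronglyMeasurable w) {m : ℝ}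
    (hm : ∀ t, ‖w t‖ ≤ m) (p : ℝ≥0∞) :
    MemLp (fun t => F (pev γ t, w t)) p (volume.restrict (Set.Icc a b)) := by
  obtain ⟨C, -, hC⟩ := exists_forall_norm_comp_le hF γ m
  exact MemLp.of_bound (aestronglyMeasurable_comp_pev hF γ hw) C
    (ae_of_all _ fun t => hC γ (by simp) t _ (hm t))

theorem tendsto_pev {γs : ℕ → CPath a b n} {γ : CPath a b n} (h : Tendsto γs atTop (𝓝 γ)) (t : ℝ) :
    Tendsto (fun k => pev (γs k) t) atTop (𝓝 (pev γ t)) :=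
  ((continuous_pev_left t).tendsto γ).comp h

theorem tendsto_integral_comp_pev {E : Type*} [NormedAddCommGroup E] [NormedSpace ℝ E]
    {F : Eu n × Eu n → E}
    (hF : Continuous F) {γs : ℕ → CPath a b n} {γ : CPath a b n} (h : Tendsto γs atTop (𝓝 γ))
    {w : ℝ → Eu n} (hw : StronglyMeasurable w) {m : ℝ} (hm : ∀ t, ‖w t‖ ≤ m) :
    Tendsto (fun k => ∫ t in Set.Icc a b, F (pev (γs k) t, w t)) atTop
      (𝓝 (∫ t in Set.Icc a b, F (pev γ t, w t))) := by
  obtain ⟨C, -, hC⟩ := exists_forall_norm_comp_le hF γ m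
  have hd : ∀ᶠ k in atTop, dist (γs k) γ ≤ 1 :=
    (tendsto_iff_dist_tendsto_zero.1 h).eventually_le_const zero_lt_one
  refine tendsto_integral_filter_of_dominated_convergence (fun _ => C)
    (Eventually.of_forall fun k => aestronglyMeasurable_comp_pev hF _ hw) ?_
    (integrable_const _) (ae_of_all _ fun t => ?_)
  · filter_upwards [hd] with k hk
    exact ae_of_all _ fun t => hC _ hk t _ (hm t)
  · exact (hF.tendsto _).comp ((tendsto_pev h t).prodMk_nhds tendsto_const_nhds)

theorem tendsto_integral_sq_velGrad_sub (hL : IsTonelli L c₁ c₂ x₀)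
    {γs : ℕ → CPath a b n} {γ : CPath a b n} (h : Tendsto γs atTop (𝓝 γ))
    {w : ℝ → Eu n} (hw : StronglyMeasurable w) {m : ℝ} (hm : ∀ t, ‖w t‖ ≤ m) :
    Tendsto (fun k => ∫ t in Set.Icc a b,
      ‖velGrad L (pev (γs k) t, w t) - velGrad L (pev γ t, w t)‖ ^ 2) atTop (𝓝 0) := by
  have hc := hL.continuous_velGrad
  obtain ⟨C, hC0, hC⟩ := exists_forall_norm_comp_le hc γ m
  have hd : ∀ᶠ k in atTop, dist (γs k) γ ≤ 1 :=
    (tendsto_iff_dist_tendsto_zero.1 h).eventually_le_const zero_lt_one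
  have : (0 : ℝ) = ∫ t in Set.Icc a b, (0 : ℝ) := by simp
  rw [this]
  refine tendsto_integral_filter_of_dominated_convergence (fun _ => (C + C) ^ 2)
    (Eventually.of_forall fun k => (((aestronglyMeasurable_comp_pev hc _ hw).sub
      (aestronglyMeasurable_comp_pev hc _ hw)).norm.pow 2)) ?_
    (integrable_const _) (ae_of_all _ fun t => ?_)
  · filter_upwards [hd] with k hk
    refine ae_of_all _ fun t => ?_
    rw [Real.norm_of_nonneg (by positivity)]
    gcongr
    exact (norm_sub_le _ _).trans (add_le_add (hC _ hk t _ (hm t)) (hC γ (by simp) t _ (hm t)))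
  · have h1 : Tendsto (fun k => velGrad L (pev (γs k) t, w t)) atTop
        (𝓝 (velGrad L (pev γ t, w t))) :=
      (hc.tendsto _).comp ((tendsto_pev h t).prodMk_nhds tendsto_const_nhds)
    have h2 := ((h1.sub_const (velGrad L (pev γ t, w t))).norm).pow 2
    simpa using h2

theorem isDer_of_tendsto_weakly {l : Filter ℕ} [l.NeBot] {γs : ℕ → CPath a b n}
    {γ : CPath a b n} (h : Tendsto γs l (𝓝 γ)) {g : ℕ → ℝ → Eu n} {w : ℝ → Eu n}
    (hg : ∀ k, IsDer (γs k) (g k)) (hw : MemLp w 2 (volume.restrict (Set.Icc a b)))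
    (hgw : ∀ e : ℝ → Eu n, MemLp e 2 (volume.restrict (Set.Icc a b)) →
      Tendsto (fun k => ∫ t in Set.Icc a b, inner ℝ (e t) (g k t)) l
        (𝓝 (∫ t in Set.Icc a b, inner ℝ (e t) (w t)))) :
    IsDer γ w := by
  have hwi : IntegrableOn w (Set.Icc a b) := hw.integrable (by norm_num)
  have key : ∀ (f : ℝ → Eu n), IntegrableOn f (Set.Icc a b) → ∀ t ∈ Set.Icc a b, ∀ z : Eu n,
      ∫ s in Set.Icc a b, inner ℝ ((Set.Ioc a t).indicator (fun _ => z) s) (f s) =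
        inner ℝ z (∫ s in a..t, f s) := fun f hf t ht z => by
    have hsub : Set.Ioc a t ⊆ Set.Icc a b := fun s hs => ⟨hs.1.le, hs.2.trans ht.2⟩
    rw [intervalIntegral.integral_of_le ht.1, ← integral_inner (hf.mono_set hsub)]
    have e : (fun s => inner ℝ ((Set.Ioc a t).indicator (fun _ => z) s) (f s)) =
        (Set.Ioc a t).indicator fun s => (inner ℝ z (f s) : ℝ) := by
      ext s
      by_cases hs : s ∈ Set.Ioc a t <;> simp [hs]
    rw [e, setIntegral_indicator measurableSet_Ioc, Set.inter_eq_right.2 hsub]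
  refine ⟨hwi, fun t ht => ?_⟩
  have hev : ∀ s, Tendsto (fun k => pev (γs k) s) l (𝓝 (pev γ s)) := fun s =>
    ((continuous_pev_left s).tendsto γ).comp h
  rw [← sub_eq_iff_eq_add']
  refine ext_inner_left ℝ fun z => ?_
  have h1 := hgw _ ((memLp_const (μ := volume.restrict (Set.Icc a b)) (p := 2) z).indicator
    (measurableSet_Ioc (a := a) (b := t)))
  rw [key w hwi t ht z] at h1
  have h2 : Tendsto (fun k => (inner ℝ z (pev (γs k) t - pev (γs k) a) : ℝ)) l
      (𝓝 (inner ℝ z (pev γ t - pev γ a))) :=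
    tendsto_const_nhds.inner ((hev t).sub (hev a))
  refine tendsto_nhds_unique h2 (h1.congr fun k => ?_)
  rw [key _ (hg k).integrableOn t ht z, (hg k).eq_add t ht, add_sub_cancel_left]

theorem IsTonelli.integral_tangent_le (hL : IsTonelli L c₁ c₂ x₀)
    {l : Filter ℕ} [l.NeBot] (hl : l ≤ atTop) {γs : ℕ → CPath a b n}
    {γ : CPath a b n} (h : Tendsto γs atTop (𝓝 γ)) {g : ℕ → ℝ → Eu n} {u : ℝ → Eu n}
    (hg2 : ∀ k, MemLp (g k) 2 (volume.restrict (Set.Icc a b)))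
    {B : ℝ} (hB : ∀ k, ∫ t in Set.Icc a b, ‖g k t‖ ^ 2 ≤ B)
    (hgu : ∀ e : ℝ → Eu n, MemLp e 2 (volume.restrict (Set.Icc a b)) →
      Tendsto (fun k => ∫ t in Set.Icc a b, inner ℝ (e t) (g k t)) l
        (𝓝 (∫ t in Set.Icc a b, inner ℝ (e t) (u t))))
    (hi : ∀ k, IntegrableOn (fun t => L (pev (γs k) t) (g k t)) (Set.Icc a b))
    {c : ℝ} (hc : ∀ k, ∫ t in Set.Icc a b, L (pev (γs k) t) (g k t) ≤ c)
    {w : ℝ → Eu n} (hw : StronglyMeasurable w) {m : ℝ} (hm : ∀ t, ‖w t‖ ≤ m) :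
    (∫ t in Set.Icc a b, L (pev γ t) (w t)) +
      (∫ t in Set.Icc a b, inner ℝ (velGrad L (pev γ t, w t)) (u t)) -
      (∫ t in Set.Icc a b, inner ℝ (velGrad L (pev γ t, w t)) (w t)) ≤ c := by
  have hP := hL.continuous_velGrad
  have hF1 : Continuous fun p : Eu n × Eu n => L p.1 p.2 := hL.continuous
  have hF2 : Continuous fun p : Eu n × Eu n => (inner ℝ (velGrad L p) p.2 : ℝ) :=
    hP.inner continuous_snd
  have t1 := (tendsto_integral_comp_pev hF1 h hw hm).mono_left hl
  have t2 := (tendsto_integral_comp_pev hF2 h hw hm).mono_left hl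
  have hPk : ∀ η : CPath a b n, MemLp (fun t => velGrad L (pev η t, w t)) 2
    (volume.restrict (Set.Icc a b)) := fun η => memLp_comp_pev hP η hw hm 2
  have t3 := hgu _ (hPk γ)
  have t4 := tendsto_integral_inner_zero hg2 hB
    (Eventually.of_forall fun k => (hPk (γs k)).sub (hPk γ))
    ((tendsto_integral_sq_velGrad_sub hL h hw hm).mono_left hl)
  have t5 := ((t1.add t3).sub t2).add t4
  rw [add_zero] at t5
  refine le_of_tendsto t5 (Eventually.of_forall fun k => ?_)
  have hin : ∀ {e f : ℝ → Eu n}, MemLp e 2 (volume.restrict (Set.Icc a b)) →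
      MemLp f 2 (volume.restrict (Set.Icc a b)) →
      Integrable (fun t => (inner ℝ (e t) (f t) : ℝ)) (volume.restrict (Set.Icc a b)) :=
    fun he hf => by
      refine (L2.integrable_inner (𝕜 := ℝ) (he.toLp _) (hf.toLp _)).congr ?_
      filter_upwards [he.coeFn_toLp, hf.coeFn_toLp] with t h1 h2
      rw [h1, h2]
  have i1 : Integrable (fun t => L (pev (γs k) t) (w t)) (volume.restrict (Set.Icc a b)) :=
    memLp_one_iff_integrable.1 (memLp_comp_pev hF1 (γs k) hw hm 1)
  have i2 := hin (hPk γ) (hg2 k)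
  have i3 : Integrable (fun t => (inner ℝ (velGrad L (pev (γs k) t, w t)) (w t) : ℝ))
      (volume.restrict (Set.Icc a b)) :=
    memLp_one_iff_integrable.1 (memLp_comp_pev hF2 (γs k) hw hm 1)
  have i4 := hin ((hPk (γs k)).sub (hPk γ)) (hg2 k)
  rw [← integral_add' i1 i2, ← integral_sub' (i1.add i2) i3,
    ← integral_add' ((i1.add i2).sub i3) i4]
  refine le_trans (integral_mono (((i1.add i2).sub i3).add i4) (hi k) fun t => ?_) (hc k)
  have := hL.tangent_velGrad (pev (γs k) t) (g k t) (w t)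
  simp only [Pi.sub_apply, Pi.add_apply, inner_sub_left]
  linarith

theorem IsTonelli.isClosed_setOf_action_le (hL : IsTonelli L c₁ c₂ x₀) (hab : a < b) (c : ℝ) :
    IsClosed {γ : CPath a b n | action L a b γ ≤ (c : EReal)} := by
  refine IsSeqClosed.isClosed fun γs γ hγs h => ?_
  wlog hd : ∀ k, dist (γs k) γ ≤ 1 generalizing γs
  · obtain ⟨N, hN⟩ := eventually_atTop.1
      ((tendsto_iff_dist_tendsto_zero.1 h).eventually_le_const zero_lt_one)
    exact this (γs := fun k => γs (k + N)) (fun k => hγs (k + N)) ((tendsto_add_atTop_iff_nat N).2 h)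
      (fun k => hN _ (Nat.le_add_left _ _))
  have hex : ∀ k, ∃ g, IsDer (γs k) g ∧
      IntegrableOn (fun t => L (pev (γs k) t) (g t)) (Set.Icc a b) := fun k =>
    exists_isDer_of_action_ne_top hab (ne_top_of_le_ne_top (EReal.coe_ne_top c) (hγs k))
  choose g hg hi using hex
  have hc : ∀ k, ∫ t in Set.Icc a b, L (pev (γs k) t) (g k t) ≤ c := fun k => by
    have := hγs k
    rw [Set.mem_ofPred_eq, (hg k).action_eq_integral hab (hi k)] at this
    exact_mod_cast this
  have hg2 : ∀ k, MemLp (g k) 2 (volume.restrict (Set.Icc a b)) := fun k =>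
    (memLp_two_iff_integrable_sq_norm (hg k).aestronglyMeasurable).2 (hL.integrableOn_sq (hg k) (hi k))
  obtain ⟨R, hR0, hR⟩ := exists_norm_pev_le γ
  have hRk : ∀ k, ∀ t ∈ Set.Icc a b, ‖pev (γs k) t - x₀‖ ^ 2 ≤ (1 + R + ‖x₀‖) ^ 2 := fun k t _ => by
    gcongr
    calc ‖pev (γs k) t - x₀‖ = ‖(pev (γs k) t - pev γ t) + pev γ t - x₀‖ := by abel_nf
      _ ≤ 1 + R + ‖x₀‖ := (norm_sub_le _ _).trans (by
        gcongr
        exact (norm_add_le _ _).trans (add_le_add ((norm_pev_sub_le _ _ _).trans (hd k)) (hR t)))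
  have hB : ∀ k, ∫ t in Set.Icc a b, ‖g k t‖ ^ 2 ≤
      c₁⁻¹ * (c + (b - a) * (c₂ * (1 + (1 + R + ‖x₀‖) ^ 2))) := fun k => by
    rw [le_inv_mul_iff₀ hL.pos₁]
    exact (hL.integral_sq_le hab (hg k) (hi k) (hRk k)).trans (by gcongr; exact hc k)
  obtain ⟨u, hu, hu2, hgu⟩ := exists_weak_limit_memLp hg2 hB (hyperfilter ℕ)
  have hl : (hyperfilter ℕ : Filter ℕ) ≤ atTop := by
    rw [← Nat.cofinite_eq_atTop]; exact hyperfilter_le_cofinite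
  have hder : IsDer γ u := isDer_of_tendsto_weakly (h.mono_left hl) hg hu2 hgu
  let w : ℕ → ℝ → Eu n := fun m => {t | ‖u t‖ ≤ m}.indicator u
  have hwm : ∀ m, StronglyMeasurable (w m) := fun m =>
    hu.indicator (measurableSet_le hu.norm.measurable measurable_const)
  have hwb : ∀ m t, ‖w m t‖ ≤ m := fun m t => by
    by_cases ht : ‖u t‖ ≤ m
    · simp [w, ht]
    · simp [w, ht]
  have hui : IntegrableOn u (Set.Icc a b) := hder.integrableOn
  have hP := hL.continuous_velGrad
  have hF1 : Continuous fun p : Eu n × Eu n => L p.1 p.2 := hL.continuous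
  have hF2 : Continuous fun p : Eu n × Eu n => (inner ℝ (velGrad L p) p.2 : ℝ) :=
    hP.inner continuous_snd
  obtain ⟨C, hC0, hC⟩ := exists_forall_norm_comp_le hP γ 0
  have hgrow : ∀ t v, -(c₂ * (1 + (R + ‖x₀‖) ^ 2)) ≤ L (pev γ t) v := fun t v => by
    have h1 := hL.growth (pev γ t) v
    have h2 : ‖pev γ t - x₀‖ ^ 2 ≤ (R + ‖x₀‖) ^ 2 := by
      gcongr; exact (norm_sub_le _ _).trans (by gcongr; exact hR t)
    nlinarith [hL.pos₂, hL.pos₁, sq_nonneg ‖v‖, mul_nonneg hL.pos₁.le (sq_nonneg ‖v‖),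
      mul_le_mul_of_nonneg_left h2 hL.pos₂.le]
  let f : ℕ → ℝ → ℝ := fun m t => L (pev γ t) (w m t) +
    inner ℝ (velGrad L (pev γ t, w m t)) (u t) - inner ℝ (velGrad L (pev γ t, w m t)) (w m t)
  have i1 : ∀ m, Integrable (fun t => L (pev γ t) (w m t)) (volume.restrict (Set.Icc a b)) :=
    fun m => memLp_one_iff_integrable.1 (memLp_comp_pev hF1 γ (hwm m) (hwb m) 1)
  have i2 : ∀ m, Integrable (fun t => (inner ℝ (velGrad L (pev γ t, w m t)) (u t) : ℝ))
      (volume.restrict (Set.Icc a b)) := fun m => by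
    obtain ⟨C, -, hC⟩ := exists_forall_norm_comp_le hP γ m
    refine (hui.norm.const_mul C).mono' ((aestronglyMeasurable_comp_pev hP γ (hwm m)).inner
      hui.aestronglyMeasurable) (ae_of_all _ fun t => (norm_inner_le_norm _ _).trans ?_)
    gcongr
    exact hC γ (by simp) t _ (hwb m t)
  have i3 : ∀ m, Integrable (fun t => (inner ℝ (velGrad L (pev γ t, w m t)) (w m t) : ℝ))
      (volume.restrict (Set.Icc a b)) :=
    fun m => memLp_one_iff_integrable.1 (memLp_comp_pev hF2 γ (hwm m) (hwb m) 1)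
  have key := integrable_and_integral_le_of_tendsto (μ := volume.restrict (Set.Icc a b))
    (f := f) (F := fun t => L (pev γ t) (u t))
    (G := fun t => c₂ * (1 + (R + ‖x₀‖) ^ 2) + C * ‖u t‖) (c := c)
    (fun m => ((i1 m).add (i2 m)).sub (i3 m)) ((integrable_const _).add (hui.norm.const_mul C))
    (fun m t => ?_) (fun t => ?_) (hL.aestronglyMeasurable hui.aestronglyMeasurable) (fun m => ?_)
  · rw [Set.mem_ofPred_eq, hder.action_eq_integral hab key.1]
    exact_mod_cast key.2
  · have h1 := hgrow t (w m t)
    by_cases ht : ‖u t‖ ≤ m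
    · have hw : w m t = u t := by simp [w, ht]
      have : 0 ≤ C * ‖u t‖ := by positivity
      simp only [f, hw] at h1 ⊢
      linarith
    · have hw : w m t = 0 := by simp [w, ht]
      have h2 : -(C * ‖u t‖) ≤ inner ℝ (velGrad L (pev γ t, (0 : Eu n))) (u t) := by
        refine neg_le_of_abs_le ((abs_real_inner_le_norm _ _).trans ?_)
        gcongr
        exact hC γ (by simp) t _ (by simp)
      simp only [f, hw, inner_zero_right] at h1 ⊢
      linarith
  · refine tendsto_const_nhds.congr' ?_
    filter_upwards [eventually_ge_atTop ⌈‖u t‖⌉₊] with m hm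
    have ht : ‖u t‖ ≤ m := (Nat.le_ceil _).trans (by exact_mod_cast hm)
    have hw : w m t = u t := by simp [w, ht]
    simp [f, hw]
  · have := hL.integral_tangent_le hl h hg2 hB hgu hi hc (hwm m) (hwb m)
    rw [← integral_add' (i1 m) (i2 m), ← integral_sub' ((i1 m).add (i2 m)) (i3 m)] at this
    exact this

theorem IsTonelli.lowerSemicontinuous_action (hL : IsTonelli L c₁ c₂ x₀) (hab : a < b) :
    LowerSemicontinuous (action (n := n) L a b) := by
  rw [lowerSemicontinuous_iff_isClosed_preimage]
  intro y
  induction y with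
  | bot =>
    have : action (n := n) L a b ⁻¹' Set.Iic ⊥ = ∅ := by
      ext γ
      simp [action_ne_bot]
    rw [this]; exact isClosed_empty
  | coe c => exact hL.isClosed_setOf_action_le hab c
  | top => simp

/-- The inverse of the primitive of a density `l ≥ 1/2` close to `1` is a change of time. -/
theorem exists_timeChange {a b : ℝ} {l : ℝ → ℝ≥0} (hpos : ∀ t, 2⁻¹ ≤ l t)
    (hi : Integrable fun t => (l t : ℝ) - 1) (h0 : ∫ t in a..b, ((l t : ℝ) - 1) = 0) :
    ∃ σ : ℝ → ℝ, StrictMono σ ∧ Continuous σ ∧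
      MeasurePreserving σ volume (volume.withDensity fun t => (l t : ℝ≥0∞)) ∧
      σ a = a ∧ σ b = b ∧ ∀ s, |σ s - s| ≤ ∫ t, |(l t : ℝ) - 1| := by
  have hint : ∀ s t : ℝ, IntervalIntegrable (fun t => (l t : ℝ)) volume s t := fun s t => by
    simpa using (hi.intervalIntegrable (a := s) (b := t)).add
      (intervalIntegrable_const (c := (1 : ℝ)))
  set τ : ℝ → ℝ := fun t => a + ∫ u in a..t, (l u : ℝ) with hτ
  have hsub : ∀ s t, τ t - τ s = ∫ u in s..t, (l u : ℝ) := fun s t => by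
    rw [hτ, ← intervalIntegral.integral_interval_sub_left (hint a t) (hint a s)]
    ring
  have hsub' : ∀ s t, τ t - τ s - (t - s) = ∫ u in s..t, ((l u : ℝ) - 1) := fun s t => by
    rw [intervalIntegral.integral_sub (hint s t) intervalIntegrable_const, hsub]
    simp
  have hτa : τ a = a := by simp [hτ]
  have hτb : τ b = b := by
    have := hsub' a b
    rw [h0, hτa] at this
    linarith
  have hτd : ∀ t, |τ t - t| ≤ ∫ u, |(l u : ℝ) - 1| := fun t => by
    have := hsub' a t
    rw [hτa, sub_sub_sub_cancel_right] at this
    rw [this, ← Real.norm_eq_abs]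
    refine (intervalIntegral.norm_integral_le_integral_norm_uIoc).trans ?_
    exact setIntegral_le_integral hi.abs (ae_of_all _ fun _ => abs_nonneg _)
  have hmono : StrictMono τ := fun s t hst => by
    have h : ∫ _ in s..t, (2⁻¹ : ℝ) ≤ ∫ u in s..t, (l u : ℝ) :=
      intervalIntegral.integral_mono_on hst.le intervalIntegrable_const (hint s t)
        fun u _ => by exact_mod_cast hpos u
    rw [← hsub, intervalIntegral.integral_const, smul_eq_mul] at h
    linarith
  have hcont : Continuous τ :=
    continuous_const.add (intervalIntegral.continuous_primitive hint a)
  have hsurj : Function.Surjective τ := by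
    refine hcont.surjective ?_ ?_
    · refine tendsto_atTop_mono (f := fun t => t - ∫ u, |(l u : ℝ) - 1|) (fun t => ?_)
        (tendsto_atTop_add_const_right _ _ tendsto_id)
      linarith [(abs_le.1 (hτd t)).1]
    · refine tendsto_atBot_mono (fun t => ?_)
        (tendsto_atBot_add_const_right _ (∫ u, |(l u : ℝ) - 1|) tendsto_id)
      rw [id]
      linarith [(abs_le.1 (hτd t)).2]
  set e := hmono.orderIsoOfSurjective τ hsurj with he
  have heτ : ∀ t, e t = τ t := fun t => rfl
  have hστ : ∀ t, e.symm (τ t) = t := fun t => by rw [← heτ, e.symm_apply_apply]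
  refine ⟨e.symm, e.symm.strictMono, e.symm.continuous, ⟨e.symm.continuous.measurable, ?_⟩, ?_, ?_,
    fun s => ?_⟩
  · have hpre : ∀ c d : ℝ, (e.symm : ℝ → ℝ) ⁻¹' Set.Ioc c d = Set.Ioc (τ c) (τ d) := fun c d => by
      simp [OrderIso.preimage_Ioc, heτ]
    refine Measure.ext_of_Ioc' _ _ (fun c d _ => ?_) fun c d hcd => ?_
    · rw [Measure.map_apply e.symm.continuous.measurable measurableSet_Ioc, hpre]
      simp
    · rw [Measure.map_apply e.symm.continuous.measurable measurableSet_Ioc, hpre, Real.volume_Ioc,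
        withDensity_apply _ measurableSet_Ioc, hsub, intervalIntegral.integral_of_le hcd.le,
        ofReal_integral_eq_lintegral_ofReal (hint c d).1 (ae_of_all _ fun u => (l u).2)]
      simp
  · rw [← hτa, hστ, hτa]
  · rw [← hτb, hστ, hτb]
  · have := hτd (e.symm s)
    rw [← heτ, e.apply_symm_apply, abs_sub_comm] at this
    exact this

/-- Change of variables for a change of time. -/
theorem timeChange_integral {E : Type*} [NormedAddCommGroup E] [NormedSpace ℝ E] {a : ℝ}
    {l : ℝ → ℝ≥0} (hl : Measurable l) {σ : ℝ → ℝ} (hσ : StrictMono σ) (hσc : Continuous σ)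
    (hσm : MeasurePreserving σ volume (volume.withDensity fun t => (l t : ℝ≥0∞)))
    (ha : σ a = a) (s : ℝ) (f : ℝ → E) :
    (IntegrableOn (fun t => f (σ t)) (Set.Icc a s) ↔
      IntegrableOn (fun t => (l t : ℝ) • f t) (Set.Icc a (σ s))) ∧
    ∫ t in Set.Icc a s, f (σ t) = ∫ t in Set.Icc a (σ s), (l t : ℝ) • f t := by
  have hemb : MeasurableEmbedding σ := hσc.measurableEmbedding hσ.injective
  have hpre : σ ⁻¹' Set.Icc a (σ s) = Set.Icc a s := by
    ext t
    simp only [Set.mem_preimage, Set.mem_Icc, hσ.le_iff_le]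
    nth_rewrite 1 [← ha]
    rw [hσ.le_iff_le]
  constructor
  · rw [← hpre]
    have := hσm.integrableOn_comp_preimage hemb (f := f) (s := Set.Icc a (σ s))
    refine this.trans ?_
    rw [IntegrableOn, restrict_withDensity measurableSet_Icc,
      integrable_withDensity_iff_integrable_smul hl]
    rfl
  · rw [← hpre, hσm.setIntegral_preimage_emb hemb,
      setIntegral_withDensity_eq_setIntegral_smul hl _ measurableSet_Icc]
    rfl

/-- Densities with which the integrable velocity `u` can be slowed down to a bounded velocity, the
time lost being regained where `u` is bounded by a constant. -/
theorem exists_slowing_densities {E : Type*} [NormedAddCommGroup E] {a b : ℝ} (hab : a < b)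
    {u : ℝ → E} (hu : Integrable u) (hum : StronglyMeasurable u)
    (hsupp : ∀ t, t ∉ Set.Icc a b → u t = 0) :
    ∃ (m : ℝ) (l : ℕ → ℝ → ℝ≥0), (∀ k, Measurable (l k)) ∧
      Tendsto (fun k => ∫ t, |(l k t : ℝ) - 1|) atTop (𝓝 0) ∧
      (∀ t, Tendsto (fun k => (l k t : ℝ)) atTop (𝓝 1)) ∧
      ∀ᶠ k : ℕ in atTop, Integrable (fun t => (l k t : ℝ) - 1) ∧
        ∫ t in a..b, ((l k t : ℝ) - 1) = 0 ∧
        ∀ t, 2⁻¹ ≤ l k t ∧ ‖u t‖ ≤ 2 * k * l k t ∧ (l k t : ℝ) ≤ 1 + ‖u t‖ ∧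
          ((1 : ℝ) ≤ l k t ∨ ‖u t‖ ≤ m ∧ (l k t : ℝ) ≤ 1) := by
  obtain ⟨m, hm⟩ : ∃ m : ℕ, 0 < volume (Set.Icc a b ∩ {t | ‖u t‖ ≤ m}) := by
    refine exists_measure_pos_of_not_measure_iUnion_null fun h => ?_
    have hU : (⋃ i : ℕ, {t | ‖u t‖ ≤ i}) = Set.univ :=
      Set.iUnion_eq_univ_iff.2 fun t => exists_nat_ge ‖u t‖
    rw [← Set.inter_iUnion, hU, Set.inter_univ, Real.volume_Icc, ENNReal.ofReal_eq_zero] at h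
    linarith
  set A := Set.Icc a b ∩ {t | ‖u t‖ ≤ m} with hA
  have hAm : MeasurableSet A :=
    measurableSet_Icc.inter (hum.norm.measurable measurableSet_Iic)
  have hAfin : volume A ≠ ∞ :=
    ((measure_mono Set.inter_subset_left).trans_lt measure_Icc_lt_top).ne
  set v := volume.real A with hv
  have hv0 : 0 < v := ENNReal.toReal_pos hm.ne' hAfin
  set f : ℕ → ℝ → ℝ := fun k t => max 1 (‖u t‖ / k) with hf
  have hf1 : ∀ k t, 1 ≤ f k t := fun k t => le_max_left _ _
  have hfm : ∀ k, Measurable (f k) := fun k =>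
    measurable_const.max (hum.norm.measurable.div_const _)
  have hfle : ∀ k t, f k t - 1 ≤ ‖u t‖ := fun k t => by
    rw [sub_le_iff_le_add]
    refine max_le (by linarith [norm_nonneg (u t)]) ?_
    rcases Nat.eq_zero_or_pos k with rfl | hk
    · simp; positivity
    · have : (1 : ℝ) ≤ k := by exact_mod_cast hk
      linarith [div_le_self (norm_nonneg (u t)) this]
  have hfi : ∀ k, Integrable fun t => f k t - 1 := fun k =>
    hu.norm.mono' ((hfm k).sub_const 1).aestronglyMeasurable (ae_of_all _ fun t => by
      rw [Real.norm_eq_abs, abs_of_nonneg (by linarith [hf1 k t])]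
      exact hfle k t)
  have hflim : ∀ t, Tendsto (fun k => f k t) atTop (𝓝 1) := fun t => by
    have := (tendsto_const_nhds (x := (1 : ℝ))).max
      ((tendsto_const_nhds (x := ‖u t‖)).div_atTop (tendsto_natCast_atTop_atTop (R := ℝ)))
    simpa using this
  set c : ℕ → ℝ := fun k => ∫ t, (f k t - 1) with hc
  have hc0 : ∀ k, 0 ≤ c k := fun k => integral_nonneg fun t => sub_nonneg.2 (hf1 k t)
  have hclim : Tendsto c atTop (𝓝 0) := by
    have := tendsto_integral_of_dominated_convergence (F := fun k t => f k t - 1)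
      (f := fun _ => 0) (fun t => ‖u t‖)
      (fun k => (hfi k).aestronglyMeasurable) hu.norm (fun k => ae_of_all _ fun t => by
        rw [Real.norm_eq_abs, abs_of_nonneg (by linarith [hf1 k t])]
        exact hfle k t) (ae_of_all _ fun t => by simpa using (hflim t).sub_const 1)
    simpa using this
  set θ : ℕ → ℝ := fun k => c k / v with hθ
  have hθ0 : ∀ k, 0 ≤ θ k := fun k => div_nonneg (hc0 k) hv0.le
  have hθlim : Tendsto θ atTop (𝓝 0) := by simpa using hclim.div_const v
  set d : ℕ → ℝ → ℝ := fun k t => A.indicator (fun _ => θ k) t with hd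
  have hd0 : ∀ k t, 0 ≤ d k t := fun k t => Set.indicator_nonneg (fun _ _ => hθ0 k) t
  have hdle : ∀ k t, d k t ≤ θ k := fun k t => Set.indicator_le_self' (fun _ _ => hθ0 k) t
  have hdi : ∀ k, Integrable (d k) := fun k =>
    (integrable_indicator_iff hAm).2 (integrableOn_const hAfin)
  have hdint : ∀ k, ∫ t, d k t = c k := fun k => by
    rw [hd, integral_indicator hAm, setIntegral_const, smul_eq_mul, ← hv, hθ]
    field_simp
  have hev : ∀ᶠ k in atTop, θ k ≤ 2⁻¹ := hθlim.eventually_le_const (by norm_num)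
  set l : ℕ → ℝ → ℝ≥0 := fun k t => (f k t - d k t).toNNReal with hl
  have hlc : ∀ k, θ k ≤ 2⁻¹ → ∀ t, (l k t : ℝ) = f k t - d k t := fun k hk t => by
    rw [hl]
    exact Real.coe_toNNReal _ (by linarith [hf1 k t, hdle k t])
  refine ⟨m, l, fun k => ((hfm k).sub (measurable_const.indicator hAm)).real_toNNReal, ?_, ?_, ?_⟩
  · refine squeeze_zero' (Eventually.of_forall fun k => integral_nonneg fun t => abs_nonneg _)
      ?_ (by simpa using hclim.add hclim : Tendsto (fun k => c k + c k) atTop (𝓝 0))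
    filter_upwards [hev] with k hk
    calc ∫ t, |(l k t : ℝ) - 1| ≤ ∫ t, ((f k t - 1) + d k t) := by
          refine integral_mono_of_nonneg (ae_of_all _ fun t => abs_nonneg _)
            ((hfi k).add (hdi k)) (ae_of_all _ fun t => ?_)
          simp only
          rw [hlc k hk, abs_le]
          constructor <;> linarith [hf1 k t, hd0 k t]
      _ = c k + c k := by rw [integral_add (hfi k) (hdi k), hdint]
  · intro t
    have hdlim : Tendsto (fun k => d k t) atTop (𝓝 0) :=
      squeeze_zero (fun k => hd0 k t) (fun k => hdle k t) hθlim
    have := (hflim t).sub hdlim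
    rw [sub_zero] at this
    refine this.congr' ?_
    filter_upwards [hev] with k hk
    exact (hlc k hk t).symm
  · filter_upwards [hev, eventually_ge_atTop m, eventually_ge_atTop 1] with k hk hkm hk1
    have hkpos : (0 : ℝ) < k := by exact_mod_cast hk1
    have hi : Integrable fun t => (l k t : ℝ) - 1 := by
      refine ((hfi k).sub (hdi k)).congr (ae_of_all _ fun t => ?_)
      simp only [Pi.sub_apply]
      rw [hlc k hk]
      ring
    refine ⟨hi, ?_, fun t => ⟨?_, ?_, ?_, ?_⟩⟩
    · rw [intervalIntegral.integral_of_le hab.le, ← integral_Icc_eq_integral_Ioc,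
        setIntegral_eq_integral_of_forall_compl_eq_zero]
      · calc ∫ t, ((l k t : ℝ) - 1) = ∫ t, ((f k t - 1) - d k t) :=
              integral_congr_ae (ae_of_all _ fun t => by simp only; rw [hlc k hk]; ring)
          _ = 0 := by rw [integral_sub (hfi k) (hdi k), hdint]; exact sub_self _
      · intro t ht
        rw [hlc k hk]
        have h1 : d k t = 0 := Set.indicator_of_notMem (fun h => ht h.1) _
        simp [h1, hf, hsupp t ht]
    · rw [← NNReal.coe_le_coe, hlc k hk]
      push_cast
      linarith [hf1 k t, hdle k t]
    · rw [hlc k hk]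
      have h1 : ‖u t‖ / k ≤ f k t := le_max_right _ _
      rw [div_le_iff₀ hkpos] at h1
      nlinarith [hf1 k t, hdle k t]
    · rw [hlc k hk]
      linarith [hfle k t, hd0 k t]
    · by_cases ht : t ∈ A
      · refine Or.inr ⟨ht.2, ?_⟩
        have h1 : f k t = 1 := by
          refine max_eq_left ?_
          rw [div_le_one hkpos]
          exact ht.2.trans (by exact_mod_cast hkm)
        rw [hlc k hk, h1]
        linarith [hd0 k t]
      · left
        have h1 : d k t = 0 := Set.indicator_of_notMem ht _
        rw [hlc k hk, h1, sub_zero]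
        exact hf1 k t

theorem IsDer.congr_ae {γ : CPath a b n} {g g' : ℝ → Eu n} (h : IsDer γ g)
    (hg : g =ᵐ[volume.restrict (Set.Icc a b)] g') : IsDer γ g' := by
  refine ⟨h.integrableOn.congr_fun_ae hg, fun t ht => ?_⟩
  rw [h.eq_add t ht]
  congr 1
  refine intervalIntegral.integral_congr_ae_restrict (ae_restrict_of_ae_restrict_of_subset ?_ hg)
  rw [Set.uIoc_of_le ht.1]
  exact fun s hs => ⟨hs.1.le, hs.2.trans ht.2⟩

/-- The composition of a curve with a change of time of density `l`. -/
theorem IsDer.exists_timeChange (hab : a < b) {γ : CPath a b n} {u : ℝ → Eu n} (hu : IsDer γ u)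
    {l : ℝ → ℝ≥0} (hl : Measurable l) (hpos : ∀ t, 2⁻¹ ≤ l t)
    (hi : Integrable fun t => (l t : ℝ) - 1) (h0 : ∫ t in a..b, ((l t : ℝ) - 1) = 0) :
    ∃ (γ' : CPath a b n) (σ : ℝ → ℝ), IsDer γ' (fun s => (l (σ s) : ℝ)⁻¹ • u (σ s)) ∧
      pev γ' a = pev γ a ∧ pev γ' b = pev γ b ∧
      (∀ s ∈ Set.Icc a b, σ s ∈ Set.Icc a b ∧ pev γ' s = pev γ (σ s)) ∧
      (∀ s, |σ s - s| ≤ ∫ t, |(l t : ℝ) - 1|) ∧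
      ∀ L : Eu n → Eu n → ℝ,
        IntegrableOn (fun t => (l t : ℝ) * L (pev γ t) ((l t : ℝ)⁻¹ • u t)) (Set.Icc a b) →
        action L a b γ' =
          ((∫ t in Set.Icc a b, (l t : ℝ) * L (pev γ t) ((l t : ℝ)⁻¹ • u t) : ℝ) : EReal) := by
  obtain ⟨σ, hσ, hσc, hσm, ha, hb, hσd⟩ := _root_.exists_timeChange hpos hi h0
  have ham : a ∈ Set.Icc a b := ⟨le_rfl, hab.le⟩
  have hbm : b ∈ Set.Icc a b := ⟨hab.le, le_rfl⟩
  have hmem : ∀ s ∈ Set.Icc a b, σ s ∈ Set.Icc a b := fun s hs =>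
    ⟨ha.symm.le.trans (hσ.monotone hs.1), (hσ.monotone hs.2).trans hb.le⟩
  have hne : ∀ t, (l t : ℝ) ≠ 0 := fun t => by
    have h1 : (0 : ℝ≥0) < l t := lt_of_lt_of_le (by norm_num) (hpos t)
    exact_mod_cast h1.ne'
  set γ' : CPath a b n := ⟨fun s => γ ⟨σ s, hmem s s.2⟩, by fun_prop⟩ with hγ'
  have hpev : ∀ s ∈ Set.Icc a b, pev γ' s = pev γ (σ s) := fun s hs => by
    rw [pev_of_mem hs, pev_of_mem (hmem s hs)]
    rfl
  have hcancel : (fun t => (l t : ℝ) • (l t : ℝ)⁻¹ • u t) = u := by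
    ext1 t
    rw [smul_smul, mul_inv_cancel₀ (hne t), one_smul]
  have hder : IsDer γ' (fun s => (l (σ s) : ℝ)⁻¹ • u (σ s)) := by
    constructor
    · rw [(timeChange_integral hl hσ hσc hσm ha b fun t => (l t : ℝ)⁻¹ • u t).1, hb, hcancel]
      exact hu.integrableOn
    · intro s hs
      rw [hpev s hs, hpev a ham, ha, hu.eq_add _ (hmem s hs), intervalIntegral.integral_of_le hs.1,
        intervalIntegral.integral_of_le (hmem s hs).1, ← integral_Icc_eq_integral_Ioc,
        ← integral_Icc_eq_integral_Ioc,
        (timeChange_integral hl hσ hσc hσm ha s fun t => (l t : ℝ)⁻¹ • u t).2, hcancel]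
  refine ⟨γ', σ, hder, by rw [hpev a ham, ha], by rw [hpev b hbm, hb],
    fun s hs => ⟨hmem s hs, hpev s hs⟩, hσd, fun L hLi => ?_⟩
  have hcv := timeChange_integral hl hσ hσc hσm ha b
    fun t => L (pev γ t) ((l t : ℝ)⁻¹ • u t)
  rw [hb] at hcv
  have heq : Set.EqOn (fun s => L (pev γ (σ s)) ((l (σ s) : ℝ)⁻¹ • u (σ s)))
      (fun s => L (pev γ' s) ((l (σ s) : ℝ)⁻¹ • u (σ s))) (Set.Icc a b) := fun s hs => by
    simp only [hpev s hs]
  rw [hder.action_eq_integral hab ((hcv.1.2 hLi).congr_fun heq measurableSet_Icc),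
    ← setIntegral_congr_fun measurableSet_Icc heq, hcv.2]
  rfl

/-- Absence of a Lavrentiev gap: a curve of finite action is approximated, with the same
endpoints and in action, by curves of bounded velocity. -/
theorem IsTonelli.exists_bounded_velocity (hL : IsTonelli L c₁ c₂ x₀) (hab : a < b)
    {γ : CPath a b n} (hγ : action L a b γ ≠ ⊤) {ε : ℝ} (hε : 0 < ε) :
    ∃ (γ' : CPath a b n) (u' : ℝ → Eu n) (B : ℝ), IsDer γ' u' ∧ (∀ t, ‖u' t‖ ≤ B) ∧
      pev γ' a = pev γ a ∧ pev γ' b = pev γ b ∧ dist γ' γ < ε ∧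
      action L a b γ' ≤ action L a b γ + (ε : EReal) := by
  obtain ⟨u₀, hu₀, hu₀i⟩ := exists_isDer_of_action_ne_top hab hγ
  obtain ⟨u, hum, hu1, hsupp, hae⟩ : ∃ u : ℝ → Eu n, StronglyMeasurable u ∧ Integrable u ∧
      (∀ t, t ∉ Set.Icc a b → u t = 0) ∧ u₀ =ᵐ[volume.restrict (Set.Icc a b)] u := by
    have hm := hu₀.aestronglyMeasurable
    have h1 : u₀ =ᵐ[volume.restrict (Set.Icc a b)] (Set.Icc a b).indicator (hm.mk u₀) :=
      hm.ae_eq_mk.trans (indicator_ae_eq_restrict measurableSet_Icc).symm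
    refine ⟨(Set.Icc a b).indicator (hm.mk u₀), hm.stronglyMeasurable_mk.indicator
      measurableSet_Icc, ?_, fun t ht => Set.indicator_of_notMem ht _, h1⟩
    exact (integrable_indicator_iff measurableSet_Icc).2
      (hu₀.integrableOn.congr_fun_ae hm.ae_eq_mk)
  have hu : IsDer γ u := hu₀.congr_ae hae
  have hui : IntegrableOn (fun t => L (pev γ t) (u t)) (Set.Icc a b) :=
    hu₀i.congr_fun_ae (by filter_upwards [hae] with t ht; rw [ht])
  obtain ⟨m, l, hlm, hl1, hlt, hlev⟩ := exists_slowing_densities hab hu1 hum hsupp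
  obtain ⟨R, hR0, hR⟩ := exists_norm_pev_le γ
  obtain ⟨C₀, hC₀0, hC₀⟩ := exists_forall_norm_comp_le hL.continuous γ 0
  obtain ⟨C₁, hC₁0, hC₁⟩ := exists_forall_norm_comp_le hL.continuous γ (2 * m)
  set D := c₂ * (1 + (R + ‖x₀‖) ^ 2) with hD
  have hc₂ := hL.pos₂
  have hD0 : 0 ≤ D := by positivity
  have hlow : ∀ t v, -D ≤ L (pev γ t) v := fun t v => by
    have h1 := hL.growth (pev γ t) v
    have h2 : ‖pev γ t - x₀‖ ≤ R + ‖x₀‖ := (norm_sub_le _ _).trans (by linarith [hR t])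
    have h3 : ‖pev γ t - x₀‖ ^ 2 ≤ (R + ‖x₀‖) ^ 2 := by gcongr
    have h4 : c₂ * (1 + ‖pev γ t - x₀‖ ^ 2) ≤ D := by rw [hD]; gcongr
    have h5 : 0 ≤ c₁ * ‖v‖ ^ 2 := mul_nonneg hL.pos₁.le (by positivity)
    linarith
  set h : ℕ → ℝ → ℝ := fun k t => (l k t : ℝ) * L (pev γ t) ((l k t : ℝ)⁻¹ • u t) with hh
  have hhm : ∀ k, AEStronglyMeasurable (h k) (volume.restrict (Set.Icc a b)) := fun k => by
    have h1 : Measurable fun t => (l k t : ℝ) := (hlm k).coe_nnreal_real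
    have h2 : StronglyMeasurable fun t => (l k t : ℝ)⁻¹ • u t := h1.inv.stronglyMeasurable.smul hum
    exact h1.aestronglyMeasurable.mul (aestronglyMeasurable_comp_pev hL.continuous γ h2)
  set bd : ℝ → ℝ := fun t => |L (pev γ t) (u t)| + C₀ * ‖u t‖ + C₁ + D * (1 + ‖u t‖) with hbd
  have hbdi : IntegrableOn bd (Set.Icc a b) :=
    ((hui.abs.add (hu.integrableOn.norm.const_mul _)).add (integrable_const _)).add
      (((integrable_const _).add hu.integrableOn.norm).const_mul _)
  have hbound : ∀ᶠ k in atTop, ∀ t, ‖h k t‖ ≤ bd t := by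
    filter_upwards [hlev] with k hk t
    obtain ⟨-, -, hk⟩ := hk
    obtain ⟨g1, g2, g3, g4⟩ := hk t
    have g1' : (2⁻¹ : ℝ) ≤ l k t := by exact_mod_cast g1
    have p1 := mul_nonneg hC₀0 (norm_nonneg (u t))
    have p2 := mul_nonneg hD0 (by positivity : 0 ≤ 1 + ‖u t‖)
    have p3 := abs_nonneg (L (pev γ t) (u t))
    rw [Real.norm_eq_abs, abs_le]
    constructor
    · have q1 : (l k t : ℝ) * (-D) ≤ h k t := mul_le_mul_of_nonneg_left (hlow _ _) (l k t).2
      have q2 : (l k t : ℝ) * D ≤ (1 + ‖u t‖) * D := by gcongr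
      simp only [hbd]
      linarith
    · rcases g4 with g4 | ⟨g4, g5⟩
      · have q1 := hL.mul_inv_smul_le (pev γ t) (u t) g4
        have q2 : L (pev γ t) 0 ≤ C₀ := (le_abs_self _).trans (hC₀ γ (by simp) t 0 (by simp))
        have q3 : ((l k t : ℝ) - 1) * L (pev γ t) 0 ≤ ‖u t‖ * C₀ :=
          (mul_le_mul_of_nonneg_left q2 (by linarith)).trans
            (mul_le_mul_of_nonneg_right (by linarith) hC₀0)
        have q4 := le_abs_self (L (pev γ t) (u t))
        simp only [hbd, hh]
        linarith
      · have q1 : ‖(l k t : ℝ)⁻¹ • u t‖ ≤ 2 * m := by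
          rw [norm_smul, norm_inv, Real.norm_eq_abs, NNReal.abs_eq]
          refine mul_le_mul ?_ g4 (norm_nonneg _) (by norm_num)
          exact inv_le_of_inv_le₀ (by norm_num) g1'
        have q2 : L (pev γ t) ((l k t : ℝ)⁻¹ • u t) ≤ C₁ :=
          (le_abs_self _).trans (hC₁ γ (by simp) t _ q1)
        have q3 : h k t ≤ 1 * C₁ :=
          (mul_le_mul_of_nonneg_left q2 (l k t).2).trans (mul_le_mul_of_nonneg_right g5 hC₁0)
        simp only [hbd]
        linarith
  have hlim : Tendsto (fun k => ∫ t in Set.Icc a b, h k t) atTop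
      (𝓝 (∫ t in Set.Icc a b, L (pev γ t) (u t))) := by
    refine tendsto_integral_filter_of_dominated_convergence bd (Eventually.of_forall hhm)
      (hbound.mono fun k hk => ae_of_all _ hk) hbdi (ae_of_all _ fun t => ?_)
    have h1 : Tendsto (fun k => (l k t : ℝ)⁻¹ • u t) atTop (𝓝 (u t)) := by
      simpa using ((hlt t).inv₀ one_ne_zero).smul_const (u t)
    have h2 := (hlt t).mul ((hL.continuous.tendsto (pev γ t, u t)).comp
      ((tendsto_const_nhds (x := pev γ t)).prodMk_nhds h1))
    simpa using h2
  obtain ⟨δ, hδ, hδε⟩ := Metric.uniformContinuous_iff.1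
    (CompactSpace.uniformContinuous_of_continuous γ.continuous) (ε / 2) (by positivity)
  obtain ⟨k, hk, hkb, hkl, hkδ⟩ := (hlev.and (hbound.and
    ((hlim.eventually_lt_const (lt_add_of_pos_right _ hε)).and
      (hl1.eventually_lt_const hδ)))).exists
  obtain ⟨hki, hk0, hk⟩ := hk
  obtain ⟨γ', σ, hder, ha, hb, hpev, hσd, hact⟩ :=
    hu.exists_timeChange hab (hlm k) (fun t => (hk t).1) hki hk0
  refine ⟨γ', _, 2 * k, hder, fun t => ?_, ha, hb, ?_, ?_⟩
  · obtain ⟨g1, g2, -, -⟩ := hk (σ t)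
    have g1' : (2⁻¹ : ℝ) ≤ l k (σ t) := by exact_mod_cast g1
    rw [norm_smul, norm_inv, Real.norm_eq_abs, NNReal.abs_eq,
      inv_mul_le_iff₀ (by linarith)]
    linarith
  · refine lt_of_le_of_lt ((ContinuousMap.dist_le (by positivity)).2 fun s => ?_) (half_lt_self hε)
    obtain ⟨hs, hps⟩ := hpev s s.2
    rw [pev_of_mem s.2, pev_of_mem hs] at hps
    change dist (γ' ⟨s, s.2⟩) _ ≤ _
    rw [hps]
    exact (hδε ((hσd s).trans_lt hkδ)).le
  · rw [hact L (hbdi.mono' (hhm k) (ae_of_all _ hkb)), hu.action_eq_integral hab hui]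
    exact_mod_cast hkl.le

/-- The affine path from `z.1` to `z.2`. -/
noncomputable def affPath (a b : ℝ) {n : ℕ} (z : Eu n × Eu n) : CPath a b n :=
  ⟨fun t => z.1 + (((t : ℝ) - a) / (b - a)) • (z.2 - z.1), by fun_prop⟩

theorem continuous_affPath : Continuous (affPath a b (n := n)) :=
  ContinuousMap.continuous_of_continuous_uncurry _ (by
    change Continuous fun w : (Eu n × Eu n) × Set.Icc a b =>
      w.1.1 + (((w.2 : ℝ) - a) / (b - a)) • (w.1.2 - w.1.1)
    fun_prop)

theorem affPath_zero : affPath a b (0 : Eu n × Eu n) = 0 := by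
  ext1 t
  simp [affPath]

theorem pev_affPath {t : ℝ} (ht : t ∈ Set.Icc a b) (z : Eu n × Eu n) :
    pev (affPath a b z) t = z.1 + ((t - a) / (b - a)) • (z.2 - z.1) :=
  pev_of_mem ht

theorem pev_affPath_left (hab : a < b) (z : Eu n × Eu n) : pev (affPath a b z) a = z.1 := by
  simp [pev_affPath (Set.left_mem_Icc.2 hab.le)]

theorem pev_affPath_right (hab : a < b) (z : Eu n × Eu n) : pev (affPath a b z) b = z.2 := by
  rw [pev_affPath (Set.right_mem_Icc.2 hab.le), div_self (sub_pos.2 hab).ne', one_smul,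
    add_sub_cancel]

theorem isDer_affPath (hab : a < b) (z : Eu n × Eu n) :
    IsDer (affPath a b z) fun _ => (b - a)⁻¹ • (z.2 - z.1) := by
  refine ⟨integrable_const _, fun t ht => ?_⟩
  rw [pev_affPath_left hab, pev_affPath ht, intervalIntegral.integral_const, smul_smul,
    div_eq_mul_inv]

theorem isDer_zero : IsDer (0 : CPath a b n) fun _ => 0 := by
  refine ⟨integrable_zero _ _ _, fun t _ => ?_⟩
  unfold pev
  split_ifs <;> simp

theorem IsDer.add {γ η : CPath a b n} {u v : ℝ → Eu n} (hγ : IsDer γ u) (hη : IsDer η v) :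
    IsDer (γ + η) fun t => u t + v t := by
  refine ⟨hγ.integrableOn.add hη.integrableOn, fun t ht => ?_⟩
  have ha : a ∈ Set.Icc a b := ⟨le_rfl, ht.1.trans ht.2⟩
  rw [pev_add, pev_add, intervalIntegral.integral_add
    (hγ.integrableOn.intervalIntegrable_of_mem_Icc ha ht)
    (hη.integrableOn.intervalIntegrable_of_mem_Icc ha ht), hγ.eq_add t ht, hη.eq_add t ht]
  abel

/-- The action is continuous along affine perturbations of a curve of bounded velocity. -/
theorem IsTonelli.exists_continuous_action_add_affPath (hL : IsTonelli L c₁ c₂ x₀) (hab : a < b)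
    {γ : CPath a b n} {u : ℝ → Eu n} (hγ : IsDer γ u) {B : ℝ} (hB : ∀ t, ‖u t‖ ≤ B) :
    ∃ f : Eu n × Eu n → ℝ, Continuous f ∧
      ∀ z, action L a b (γ + affPath a b z) = (f z : EReal) := by
  set g : Eu n × Eu n → ℝ → ℝ := fun z t =>
    L (pev (γ + affPath a b z) t) (u t + (b - a)⁻¹ • (z.2 - z.1)) with hg
  have hm : ∀ z, AEStronglyMeasurable (g z) (volume.restrict (Set.Icc a b)) := fun z =>
    hL.aestronglyMeasurable (hγ.add (isDer_affPath hab z)).aestronglyMeasurable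
  have hbd : ∀ z₀, ∃ C, ∀ᶠ z in 𝓝 z₀, ∀ t, ‖g z t‖ ≤ C := fun z₀ => by
    obtain ⟨C, -, hC⟩ := exists_forall_norm_comp_le hL.continuous (γ + affPath a b z₀)
      (B + (‖(b - a)⁻¹ • (z₀.2 - z₀.1)‖ + 1))
    refine ⟨C, ?_⟩
    have h1 : Tendsto (fun z => dist (γ + affPath a b z) (γ + affPath a b z₀)) (𝓝 z₀) (𝓝 0) := by
      have h := ((continuous_const.add continuous_affPath).dist
        (continuous_const (y := γ + affPath a b z₀))).tendsto (x := z₀) (f := fun z =>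
          dist (γ + affPath a b z) (γ + affPath a b z₀))
      simpa using h
    have h2 : ContinuousAt (fun z : Eu n × Eu n => ‖(b - a)⁻¹ • (z.2 - z.1)‖) z₀ := by fun_prop
    filter_upwards [h1.eventually_le_const zero_lt_one,
      h2.eventually_le_const (lt_add_one _)] with z hz1 hz2 t
    exact hC _ hz1 t _ ((norm_add_le _ _).trans (add_le_add (hB t) hz2))
  refine ⟨fun z => ∫ t in Set.Icc a b, g z t, continuous_iff_continuousAt.2 fun z₀ => ?_,
    fun z => ?_⟩
  · obtain ⟨C, hC⟩ := hbd z₀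
    refine tendsto_integral_filter_of_dominated_convergence (fun _ => C)
      (Eventually.of_forall hm) (hC.mono fun z hz => ae_of_all _ hz) (integrable_const _)
      (ae_of_all _ fun t => ?_)
    have h1 : Continuous fun z => pev (γ + affPath a b z) t :=
      (continuous_pev_left t).comp (continuous_const.add continuous_affPath)
    have h2 : Continuous fun z : Eu n × Eu n => u t + (b - a)⁻¹ • (z.2 - z.1) := by fun_prop
    exact (hL.continuous.comp (h1.prodMk h2)).tendsto z₀
  · obtain ⟨C, hC⟩ := hbd z
    exact (hγ.add (isDer_affPath hab z)).action_eq_integral hab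
      ((integrable_const C).mono' (hm z) (ae_of_all _ hC.self_of_nhds))

/-- Affine paths with endpoints in a compact set have bounded action. -/
theorem IsTonelli.exists_action_affPath_le (hL : IsTonelli L c₁ c₂ x₀) (hab : a < b)
    {K : Set (Eu n)} (hK : IsCompact K) :
    ∃ C : ℝ, ∀ x ∈ K, ∀ y ∈ K, action L a b (affPath a b (x, y)) ≤ (C : EReal) := by
  obtain ⟨f, hf, hfa⟩ := hL.exists_continuous_action_add_affPath hab isDer_zero (B := 0) (by simp)
  obtain ⟨C, hC⟩ := (hK.prod hK).bddAbove_image hf.continuousOn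
  refine ⟨C, fun x hx y hy => ?_⟩
  rw [← zero_add (affPath a b (x, y)), hfa]
  exact_mod_cast hC (Set.mem_image_of_mem f ⟨hx, hy⟩)

/-- Near a curve of finite action there is a curve with the same endpoints all of whose small
affine perturbations have almost no more action. -/
theorem IsTonelli.exists_perturbable (hL : IsTonelli L c₁ c₂ x₀) (hab : a < b)
    {γ : CPath a b n} (hγ : action L a b γ ≠ ⊤) {ε : ℝ} (hε : 0 < ε) :
    ∃ (γ' : CPath a b n) (δ : ℝ), 0 < δ ∧ pev γ' a = pev γ a ∧ pev γ' b = pev γ b ∧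
      ∀ z : Eu n × Eu n, ‖z‖ < δ → dist (γ' + affPath a b z) γ < ε ∧
        action L a b (γ' + affPath a b z) ≤ action L a b γ + (ε : EReal) := by
  obtain ⟨γ', u', B, hu', hB, ha, hb, hd, hA⟩ := hL.exists_bounded_velocity hab hγ (half_pos hε)
  obtain ⟨f, hf, hfa⟩ := hL.exists_continuous_action_add_affPath hab hu' hB
  have hd' : Tendsto (fun z => dist (γ' + affPath a b z) γ) (𝓝 0) (𝓝 (dist γ' γ)) := by
    have h := ((continuous_const.add continuous_affPath).dist
      (continuous_const (y := γ))).tendsto (x := 0) (f := fun z => dist (γ' + affPath a b z) γ)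
    simpa [affPath_zero] using h
  obtain ⟨δ, hδ, h⟩ := Metric.eventually_nhds_iff.1
    ((hd'.eventually_lt_const (hd.trans (half_lt_self hε))).and
      ((hf.tendsto 0).eventually_lt_const (lt_add_of_pos_right _ (half_pos hε))))
  refine ⟨γ', δ, hδ, ha, hb, fun z hz => ?_⟩
  obtain ⟨h1, h2⟩ := h (by simpa using hz : dist z 0 < δ)
  refine ⟨h1, ?_⟩
  have h3 : action L a b γ' = (f 0 : EReal) := by
    rw [← hfa, affPath_zero, add_zero]
  rw [hfa]
  lift action L a b γ to ℝ using ⟨hγ, action_ne_bot⟩ with A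
  rw [h3] at hA
  have h4 : f 0 ≤ A + ε / 2 := by exact_mod_cast hA
  exact_mod_cast (by linarith : f z ≤ A + ε)

/-- For an extended-real function bounded below by `-M`, `mint` is a shifted lower integral. -/
theorem mint_eq_lintegral_sub {X : Type*} [MeasurableSpace X] {F : X → EReal} (hF : Measurable F)
    (π : Measure X) [IsProbabilityMeasure π] (M : ℝ≥0)
    (hM : ∀ᵐ x ∂π, (((-(M : ℝ)) : ℝ) : EReal) ≤ F x) :
    mint F π = ((∫⁻ x, (F x + ((M : ℝ) : EReal)).toENNReal ∂π : ℝ≥0∞) : EReal) - ((M : ℝ) : EReal) := by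
  have hmeas : Measurable fun x => (F x + ((M : ℝ) : EReal)).toENNReal :=
    (hF.add measurable_const).ereal_toENNReal
  have hpt : ∀ᵐ x ∂π, epos (F x) + M = (F x + ((M : ℝ) : EReal)).toENNReal + epos (-(F x)) ∧
      epos (-(F x)) ≤ M := by
    filter_upwards [hM] with x hx
    induction hFx : F x with
    | bot => rw [hFx] at hx; simp at hx
    | top => simp [epos]
    | coe r =>
      rw [hFx] at hx
      have hr : -(M : ℝ) ≤ r := by exact_mod_cast hx
      have h1 : epos (r : EReal) = ENNReal.ofReal r := by simp [epos]
      have h2 : epos (-(r : EReal)) = ENNReal.ofReal (-r) := by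
        rw [← EReal.coe_neg]; simp [epos]
      have hMe : (M : ℝ≥0∞) = ENNReal.ofReal (M : ℝ) := by simp
      rw [h1, h2, ← EReal.coe_add, EReal.real_coe_toENNReal, hMe]
      refine ⟨?_, ENNReal.ofReal_le_ofReal (by linarith)⟩
      rcases le_total 0 r with h | h
      · rw [ENNReal.ofReal_of_nonpos (by linarith : -r ≤ 0), add_zero,
          ENNReal.ofReal_add h M.coe_nonneg]
      · rw [ENNReal.ofReal_of_nonpos h, zero_add,
          ← ENNReal.ofReal_add (by linarith) (by linarith)]
        congr 1
        ring
  have hsum : (∫⁻ x, epos (F x) ∂π) + M =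
      (∫⁻ x, (F x + ((M : ℝ) : EReal)).toENNReal ∂π) + ∫⁻ x, epos (-(F x)) ∂π := by
    rw [← lintegral_add_left hmeas, ← lintegral_congr_ae (hpt.mono fun x hx => hx.1),
      lintegral_add_right _ measurable_const]
    simp
  have hfin : ∫⁻ x, epos (-(F x)) ∂π ≤ M :=
    (lintegral_mono_ae (hpt.mono fun x hx => hx.2)).trans (by simp)
  unfold mint
  generalize ∫⁻ x, epos (F x) ∂π = P at *
  generalize ∫⁻ x, (F x + ((M : ℝ) : EReal)).toENNReal ∂π = G at *
  generalize ∫⁻ x, epos (-(F x)) ∂π = Q at *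
  lift Q to ℝ≥0 using ne_top_of_le_ne_top ENNReal.coe_ne_top hfin
  induction P with
  | top =>
    have hG : G = ⊤ := by
      rw [top_add] at hsum
      have := hsum.symm
      simpa using this
    subst hG
    simp
  | coe p =>
    lift G to ℝ≥0 using by rintro rfl; rw [top_add] at hsum; exact absurd hsum (by simp)
    have h : (p : ℝ) + M = G + Q := by exact_mod_cast hsum
    have h' : (p : ℝ) - Q = G - M := by linarith
    have h'' := congrArg (fun r : ℝ => (r : EReal)) h'
    rw [EReal.coe_sub, EReal.coe_sub] at h''
    exact h''

/-- Weakly convergent sequences are lower semicontinuous on nonnegative lower semicontinuous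
functions. -/
theorem lintegral_le_liminf_of_lowerSemicontinuous {X : Type*} [TopologicalSpace X]
    [MeasurableSpace X] [OpensMeasurableSpace X] {μ : Measure X} {μs : ℕ → Measure X}
    (h_open : ∀ G, IsOpen G → μ G ≤ liminf (fun i => μs i G) atTop)
    {F : X → ℝ≥0∞} (hF : LowerSemicontinuous F) :
    ∫⁻ x, F x ∂μ ≤ liminf (fun i => ∫⁻ x, F x ∂μs i) atTop := by
  set H : ℕ → X → ℝ := fun k x => (min (F x) k).toReal with hH
  have hFm : Measurable F := hF.measurable
  have hHF : ∀ k x, ENNReal.ofReal (H k x) = min (F x) k := fun k x =>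
    ENNReal.ofReal_toReal (ne_top_of_le_ne_top (ENNReal.natCast_ne_top k) (min_le_right _ _))
  have hHm : ∀ k, Measurable (H k) := fun k => (hFm.min measurable_const).ennreal_toReal
  have hH0 : ∀ k x, 0 ≤ H k x := fun k x => ENNReal.toReal_nonneg
  have hHo : ∀ k (t : ℝ), 0 ≤ t → IsOpen {x | t < H k x} := fun k t ht => by
    have h1 : {x | t < H k x} = {x | ENNReal.ofReal t < min (F x) k} := by
      ext x
      rw [Set.mem_ofPred_eq, Set.mem_ofPred_eq, ← hHF k x,
        ENNReal.ofReal_lt_ofReal_iff_of_nonneg ht]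
    rw [h1]
    exact (hF.inf lowerSemicontinuous_const).isOpen_preimage _
  have hsup : ∀ x, ⨆ k : ℕ, ENNReal.ofReal (H k x) = F x := fun x => by
    simp_rw [hHF]
    rw [← inf_iSup_eq, ENNReal.iSup_natCast, inf_top_eq]
  have hmono : Monotone fun k x => ENNReal.ofReal (H k x) := fun i j hij x => by
    simp only [hHF]
    exact min_le_min le_rfl (by exact_mod_cast hij)
  calc ∫⁻ x, F x ∂μ = ⨆ k, ∫⁻ x, ENNReal.ofReal (H k x) ∂μ := by
        rw [← lintegral_iSup (fun k => (hHm k).ennreal_ofReal) hmono]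
        exact lintegral_congr fun x => (hsup x).symm
    _ ≤ _ := iSup_le fun k => ?_
  calc ∫⁻ x, ENNReal.ofReal (H k x) ∂μ = ∫⁻ t in Set.Ioi (0 : ℝ), μ {x | t < H k x} :=
        lintegral_eq_lintegral_meas_lt _ (ae_of_all _ (hH0 k)) (hHm k).aemeasurable
    _ ≤ ∫⁻ t in Set.Ioi (0 : ℝ), liminf (fun i => μs i {x | t < H k x}) atTop :=
        setLIntegral_mono' measurableSet_Ioi fun t ht => h_open _ (hHo k t (le_of_lt ht))
    _ ≤ liminf (fun i => ∫⁻ t in Set.Ioi (0 : ℝ), μs i {x | t < H k x}) atTop :=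
        lintegral_liminf_le fun i => Antitone.measurable fun s t hst =>
          measure_mono fun x hx => lt_of_le_of_lt hst hx
    _ ≤ _ := by
        refine liminf_le_liminf (Eventually.of_forall fun i => ?_)
        rw [← lintegral_eq_lintegral_meas_lt _ (ae_of_all _ (hH0 k)) (hHm k).aemeasurable]
        refine lintegral_mono fun x => ?_
        rw [hHF]
        exact min_le_left _ _

theorem WeakLim.le_liminf_measure_open {X : Type*} [TopologicalSpace X] [MeasurableSpace X]
    [OpensMeasurableSpace X] [HasOuterApproxClosed X] {πs : ℕ → Measure X} {π : Measure X}
    [hs : ∀ N, IsProbabilityMeasure (πs N)] [hp : IsProbabilityMeasure π] (h : WeakLim πs π)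
    {G : Set X} (hG : IsOpen G) : π G ≤ liminf (fun i => πs i G) atTop := by
  let P : ℕ → ProbabilityMeasure X := fun N => ⟨πs N, hs N⟩
  let Q : ProbabilityMeasure X := ⟨π, hp⟩
  have h' : Tendsto P atTop (𝓝 Q) := ProbabilityMeasure.tendsto_iff_forall_integral_tendsto.2 h
  exact ProbabilityMeasure.le_liminf_measure_open_of_tendsto h' hG

/-- The integral of a lower semicontinuous extended-real function bounded below by a common
constant is lower semicontinuous along weakly convergent sequences. -/
theorem WeakLim.mint_le_liminf {X : Type*} [TopologicalSpace X] [MeasurableSpace X]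
    [BorelSpace X] [HasOuterApproxClosed X] {πs : ℕ → Measure X} {π : Measure X}
    [∀ N, IsProbabilityMeasure (πs N)] [IsProbabilityMeasure π] (h : WeakLim πs π)
    {F : X → EReal} (hF : LowerSemicontinuous F) (M : ℝ≥0)
    (hM : ∀ᵐ x ∂π, (((-(M : ℝ)) : ℝ) : EReal) ≤ F x)
    (hMs : ∀ N, ∀ᵐ x ∂πs N, (((-(M : ℝ)) : ℝ) : EReal) ≤ F x) :
    mint F π ≤ liminf (fun N => mint F (πs N)) atTop := by
  have hadd : Continuous fun y : EReal => y + ((M : ℝ) : EReal) :=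
    continuous_iff_continuousAt.2 fun y =>
      (EReal.continuousAt_add (p := (y, ((M : ℝ) : EReal))) (Or.inr (EReal.coe_ne_bot _))
        (Or.inr (EReal.coe_ne_top _))).comp₂ continuousAt_id continuousAt_const
  have hcont : Continuous fun y : EReal => (y + ((M : ℝ) : EReal)).toENNReal :=
    EReal.continuous_toENNReal.comp hadd
  have hlsc : LowerSemicontinuous fun x => (F x + ((M : ℝ) : EReal)).toENNReal :=
    hcont.comp_lowerSemicontinuous hF fun y z hyz =>
      EReal.toENNReal_le_toENNReal (add_le_add_left hyz _)
  have hsub : Continuous fun r : ℝ≥0∞ => (r : EReal) - ((M : ℝ) : EReal) := by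
    have : Continuous fun y : EReal => y + ((-(M : ℝ) : ℝ) : EReal) :=
      continuous_iff_continuousAt.2 fun y =>
        (EReal.continuousAt_add (p := (y, ((-(M : ℝ) : ℝ) : EReal))) (Or.inr (EReal.coe_ne_bot _))
          (Or.inr (EReal.coe_ne_top _))).comp₂ continuousAt_id continuousAt_const
    simpa [sub_eq_add_neg, Function.comp_def] using this.comp continuous_coe_ennreal_ereal
  have hmono : Monotone fun r : ℝ≥0∞ => (r : EReal) - ((M : ℝ) : EReal) := fun r s hrs =>
    EReal.sub_le_sub (EReal.coe_ennreal_le_coe_ennreal_iff.2 hrs) le_rfl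
  rw [mint_eq_lintegral_sub hF.measurable π M hM]
  simp_rw [fun N => mint_eq_lintegral_sub hF.measurable (πs N) M (hMs N)]
  refine (hmono (lintegral_le_liminf_of_lowerSemicontinuous
    (fun G hG => h.le_liminf_measure_open hG) hlsc)).trans_eq ?_
  exact hmono.map_liminf_of_continuousAt _ hsub.continuousAt

theorem WeakLim.map_eq {X Y : Type*} [TopologicalSpace X] [MeasurableSpace X]
    [OpensMeasurableSpace X] [TopologicalSpace Y] [MeasurableSpace Y] [BorelSpace Y]
    [HasOuterApproxClosed Y] {πs : ℕ → Measure X} {π : Measure X} [IsFiniteMeasure π]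
    {νs : ℕ → Measure Y} {ν : Measure Y} [IsFiniteMeasure ν] (hπ : WeakLim πs π)
    (hν : WeakLim νs ν) {f : X → Y} (hf : Continuous f) (h : ∀ N, (πs N).map f = νs N) :
    π.map f = ν := by
  refine ext_of_forall_integral_eq_of_IsFiniteMeasure fun φ => ?_
  refine tendsto_nhds_unique ?_ (hν φ)
  have h1 := hπ (φ.compContinuous ⟨f, hf⟩)
  have h2 : ∀ μ : Measure X, ∫ y, φ y ∂μ.map f = ∫ x, φ (f x) ∂μ := fun μ =>
    integral_map_of_stronglyMeasurable hf.measurable φ.continuous.stronglyMeasurable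
  rw [h2]
  simp_rw [← h, h2]
  exact h1

theorem measurable_pev (t : ℝ) : Measurable fun γ : CPath a b n => pev γ t :=
  (continuous_pev_left t).measurable

/-- The action is bounded below, uniformly over curves starting in a bounded set. -/
theorem IsTonelli.exists_neg_le_action (hL : IsTonelli L c₁ c₂ x₀) (hab : a < b)
    (htime : b - a ≤ Real.sqrt (c₁ / (4 * c₂))) (R : ℝ) :
    ∃ M : ℝ≥0, ∀ γ : CPath a b n, ‖pev γ a - x₀‖ ≤ R →
      (((-(M : ℝ)) : ℝ) : EReal) ≤ action L a b γ := by
  refine ⟨((b - a) * (c₂ * (1 + 2 * R ^ 2))).toNNReal, fun γ hγ => ?_⟩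
  refine le_trans ?_ (hL.le_action hab htime hγ)
  rw [EReal.coe_le_coe_iff]
  exact neg_le_neg (Real.le_coe_toNNReal _)

/-- The lower bound for `Γ`-convergence of the constrained action functionals. -/
theorem IsTonelli.aFun_le_liminf (hL : IsTonelli L c₁ c₂ x₀) (hab : a < b)
    (htime : b - a ≤ Real.sqrt (c₁ / (4 * c₂))) {μa μb : Measure (Eu n)} [IsProbabilityMeasure μa]
    [IsProbabilityMeasure μb] {νa νb : ℕ → Measure (Eu n)} (ha : WeakLim νa μa)
    (hb : WeakLim νb μb) {R : ℝ} (hμR : ∀ᵐ x ∂μa, ‖x - x₀‖ ≤ R)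
    (hνR : ∀ N, ∀ᵐ x ∂νa N, ‖x - x₀‖ ≤ R) {πs : ℕ → Measure (CPath a b n)}
    {π : Measure (CPath a b n)} [hπs : ∀ N, IsProbabilityMeasure (πs N)] [IsProbabilityMeasure π]
    (h : WeakLim πs π) :
    aFun (action L a b) μa μb π ≤
      liminf (fun N => aFun (action L a b) (νa N) (νb N) (πs N)) atTop := by
  by_contra! hlt
  obtain ⟨c, hc, hcπ⟩ := exists_between hlt
  obtain ⟨φ, hφ, hφc⟩ := extraction_of_frequently_atTop (frequently_lt_of_liminf_lt (by isBoundedDefault) hc)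
  have hmarg : ∀ k, (πs (φ k)).map (fun γ => pev γ a) = νa (φ k) ∧
      (πs (φ k)).map (fun γ => pev γ b) = νb (φ k) := fun k => by
    by_contra hk
    have := hφc k
    rw [aFun, if_neg hk] at this
    exact not_top_lt this
  have hw : WeakLim (fun k => πs (φ k)) π := fun f => (h f).comp hφ.tendsto_atTop
  have h1 := WeakLim.map_eq hw (fun f => (ha f).comp hφ.tendsto_atTop) (continuous_pev_left a)
    fun k => (hmarg k).1
  have h2 := WeakLim.map_eq hw (fun f => (hb f).comp hφ.tendsto_atTop) (continuous_pev_left b)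
    fun k => (hmarg k).2
  obtain ⟨M, hM⟩ := hL.exists_neg_le_action hab htime R
  have hlow : ∀ ρ : Measure (CPath a b n), (∀ᵐ x ∂ρ.map (fun γ => pev γ a), ‖x - x₀‖ ≤ R) →
      ∀ᵐ γ ∂ρ, (((-(M : ℝ)) : ℝ) : EReal) ≤ action L a b γ := fun ρ hρ =>
    (ae_of_ae_map (measurable_pev a).aemeasurable hρ).mono hM
  have h3 := hw.mint_le_liminf (hL.lowerSemicontinuous_action hab) M (hlow π (h1 ▸ hμR))
    fun k => hlow _ ((hmarg k).1 ▸ hνR _)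
  have h4 : liminf (fun k => mint (action L a b) (πs (φ k))) atTop ≤ c := by
    refine liminf_le_of_frequently_le' (Frequently.of_forall fun k => ?_)
    have := hφc k
    rw [aFun, if_pos (hmarg k)] at this
    exact this.le
  rw [aFun, if_pos ⟨h1, h2⟩] at hcπ
  exact absurd (hcπ.trans_le (h3.trans h4)) (lt_irrefl _)

theorem exists_coupling_of_measure_univ_eq {X Y : Type*} [MeasurableSpace X] [MeasurableSpace Y]
    (σ : Measure X) (τ : Measure Y) [IsFiniteMeasure σ] [IsFiniteMeasure τ]
    (h : σ Set.univ = τ Set.univ) :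
    ∃ Q : Measure (X × Y), Q.map Prod.fst = σ ∧ Q.map Prod.snd = τ := by
  rcases eq_or_ne (σ Set.univ) 0 with h0 | h0
  · obtain rfl := Measure.measure_univ_eq_zero.1 h0
    obtain rfl := Measure.measure_univ_eq_zero.1 (h.symm.trans h0)
    exact ⟨0, by simp, by simp⟩
  · refine ⟨(σ Set.univ)⁻¹ • σ.prod τ, ?_, ?_⟩
    · rw [Measure.map_smul, Measure.map_fst_prod, ← h, smul_smul,
        ENNReal.inv_mul_cancel h0 (measure_ne_top _ _), one_smul]
    · rw [Measure.map_smul, Measure.map_snd_prod, smul_smul,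
        ENNReal.inv_mul_cancel h0 (measure_ne_top _ _), one_smul]

/-- Scaling a restriction so that its total mass becomes a prescribed smaller number. -/
theorem exists_le_restrict_measure_univ_eq {X : Type*} [MeasurableSpace X] (π : Measure X)
    [IsFiniteMeasure π] (A : Set X) {θ : ℝ≥0∞} (hθ : θ ≤ π A) :
    ∃ σ : Measure X, σ ≤ π.restrict A ∧ σ Set.univ = θ := by
  rcases eq_or_ne (π A) 0 with h0 | h0
  · exact ⟨0, Measure.zero_le _, by simpa [h0, eq_comm] using hθ⟩
  · have ht : π A ≠ ⊤ := measure_ne_top _ _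
    refine ⟨(θ * (π A)⁻¹) • π.restrict A, ?_, ?_⟩
    · refine Measure.le_iff.2 fun s _ => ?_
      rw [Measure.smul_apply, smul_eq_mul]
      refine mul_le_of_le_one_left' ?_
      rw [← ENNReal.mul_inv_cancel h0 ht]
      gcongr
    · rw [Measure.smul_apply, smul_eq_mul, Measure.restrict_apply_univ, mul_assoc,
        ENNReal.inv_mul_cancel h0 ht, mul_one]

theorem sum_le_of_le_restrict {X ι : Type*} [MeasurableSpace X] {π : Measure X} {s : Finset ι}
    {A : ι → Set X} (hA : ∀ i, MeasurableSet (A i)) (hd : Pairwise (Function.onFun Disjoint A))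
    {σ : ι → Measure X} (h : ∀ i, σ i ≤ π.restrict (A i)) : ∑ i ∈ s, σ i ≤ π := by
  refine Measure.le_iff.2 fun t ht => ?_
  rw [Measure.finsetSum_apply]
  calc ∑ i ∈ s, σ i t ≤ ∑ i ∈ s, π (t ∩ A i) := Finset.sum_le_sum fun i _ =>
        (h i t).trans_eq (Measure.restrict_apply ht)
    _ = π (⋃ i ∈ s, t ∩ A i) := (measure_biUnion_finset
        (fun i _ j _ hij => (hd hij).mono Set.inter_subset_right Set.inter_subset_right)
        fun i _ => ht.inter (hA i)).symm
    _ ≤ π t := measure_mono (by simp)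

/-- A coupling that matches as much mass as possible between corresponding cells. -/
theorem exists_coupling_cells {X Y ι : Type*} [MeasurableSpace X] [MeasurableSpace Y]
    (π : Measure X) (ν : Measure Y) [IsProbabilityMeasure π] [IsProbabilityMeasure ν]
    (s : Finset ι) {A : ι → Set X} {B : ι → Set Y} (hA : ∀ i, MeasurableSet (A i))
    (hB : ∀ i, MeasurableSet (B i)) (hAd : Pairwise (Function.onFun Disjoint A))
    (hBd : Pairwise (Function.onFun Disjoint B)) :
    ∃ Q : Measure (X × Y), Q.map Prod.fst = π ∧ Q.map Prod.snd = ν ∧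
      Q (⋃ i ∈ s, A i ×ˢ B i)ᶜ ≤ 1 - ∑ i ∈ s, min (π (A i)) (ν (B i)) := by
  choose σ hσ hσu using fun i => exists_le_restrict_measure_univ_eq π (A i)
    (min_le_left (π (A i)) (ν (B i)))
  choose τ hτ hτu using fun i => exists_le_restrict_measure_univ_eq ν (B i)
    (min_le_right (π (A i)) (ν (B i)))
  have hσf : ∀ i, IsFiniteMeasure (σ i) := fun i => isFiniteMeasure_of_le _ (hσ i)
  have hτf : ∀ i, IsFiniteMeasure (τ i) := fun i => isFiniteMeasure_of_le _ (hτ i)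
  choose q hq1 hq2 using fun i => exists_coupling_of_measure_univ_eq (σ i) (τ i)
    ((hσu i).trans (hτu i).symm)
  have hσs : ∑ i ∈ s, σ i ≤ π := sum_le_of_le_restrict hA hAd hσ
  have hτs : ∑ i ∈ s, τ i ≤ ν := sum_le_of_le_restrict hB hBd hτ
  have hσF : IsFiniteMeasure (∑ i ∈ s, σ i) := isFiniteMeasure_of_le _ hσs
  have hτF : IsFiniteMeasure (∑ i ∈ s, τ i) := isFiniteMeasure_of_le _ hτs
  have hrem1 : (π - ∑ i ∈ s, σ i) Set.univ = 1 - ∑ i ∈ s, min (π (A i)) (ν (B i)) := by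
    rw [Measure.sub_apply MeasurableSet.univ hσs, measure_univ, Measure.finsetSum_apply]
    simp_rw [hσu]
  have hrem2 : (ν - ∑ i ∈ s, τ i) Set.univ = 1 - ∑ i ∈ s, min (π (A i)) (ν (B i)) := by
    rw [Measure.sub_apply MeasurableSet.univ hτs, measure_univ, Measure.finsetSum_apply]
    simp_rw [hτu]
  have : IsFiniteMeasure (π - ∑ i ∈ s, σ i) := isFiniteMeasure_of_le _ Measure.sub_le
  have : IsFiniteMeasure (ν - ∑ i ∈ s, τ i) := isFiniteMeasure_of_le _ Measure.sub_le
  obtain ⟨q', hq'1, hq'2⟩ := exists_coupling_of_measure_univ_eq _ _ (hrem1.trans hrem2.symm)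
  refine ⟨q' + ∑ i ∈ s, q i, ?_, ?_, ?_⟩
  · rw [Measure.map_add _ _ measurable_fst, hq'1, ← Measure.mapₗ_apply_of_measurable measurable_fst,
      map_sum]
    simp_rw [Measure.mapₗ_apply_of_measurable measurable_fst, hq1]
    exact Measure.sub_add_cancel_of_le hσs
  · rw [Measure.map_add _ _ measurable_snd, hq'2, ← Measure.mapₗ_apply_of_measurable measurable_snd,
      map_sum]
    simp_rw [Measure.mapₗ_apply_of_measurable measurable_snd, hq2]
    exact Measure.sub_add_cancel_of_le hτs
  · have hz : ∀ i ∈ s, q i (⋃ i ∈ s, A i ×ˢ B i)ᶜ = 0 := fun i hi => by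
      have h1 : q i (Prod.fst ⁻¹' (A i)ᶜ) = 0 := by
        rw [← Measure.map_apply measurable_fst (hA i).compl, hq1]
        exact le_antisymm ((hσ i _).trans_eq
          (by rw [Measure.restrict_apply (hA i).compl]; simp)) zero_le
      have h2 : q i (Prod.snd ⁻¹' (B i)ᶜ) = 0 := by
        rw [← Measure.map_apply measurable_snd (hB i).compl, hq2]
        exact le_antisymm ((hτ i _).trans_eq
          (by rw [Measure.restrict_apply (hB i).compl]; simp)) zero_le
      refine measure_mono_null (fun w hw => ?_) (measure_union_null h1 h2)
      by_contra hc
      simp only [Set.mem_union, Set.mem_preimage, Set.mem_compl_iff, not_or, not_not] at hc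
      exact hw (Set.mem_biUnion hi ⟨hc.1, hc.2⟩)
    rw [Measure.add_apply, Measure.finsetSum_apply, Finset.sum_eq_zero hz, add_zero, ← hrem1,
      ← hq'1, Measure.map_apply measurable_fst MeasurableSet.univ]
    exact measure_mono (Set.subset_univ _)

/-- Up to a null set, Euclidean space is a countable disjoint union of open sets of small
diameter. -/
theorem exists_open_cells {n : ℕ} {μ : Measure (Eu n)} (hμ : μ ≪ volume) {ε : ℝ} (hε : 0 < ε) :
    ∃ U : ℕ → Set (Eu n), (∀ i, IsOpen (U i)) ∧ Pairwise (Function.onFun Disjoint U) ∧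
      (∀ i, ∀ x ∈ U i, ∀ y ∈ U i, dist x y < ε) ∧ μ (⋃ i, U i)ᶜ = 0 := by
  set c := TopologicalSpace.denseSeq (Eu n)
  refine ⟨fun i => Metric.ball (c i) (ε / 2) \ ⋃ j ∈ Finset.range i, Metric.closedBall (c j) (ε / 2),
    fun i => ?_, ?_, fun i x hx y hy => ?_, ?_⟩
  · exact Metric.isOpen_ball.sdiff (isClosed_biUnion_finset fun _ _ => Metric.isClosed_closedBall)
  · rw [pairwise_disjoint_on]
    refine fun i j hij => Set.disjoint_left.2 fun x hx hx' => hx'.2 ?_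
    exact Set.mem_biUnion (Finset.mem_coe.2 (Finset.mem_range.2 hij))
      (Metric.ball_subset_closedBall hx.1)
  · have h1 := Metric.mem_ball.1 hx.1
    have h2 := Metric.mem_ball.1 hy.1
    linarith [dist_triangle_right x y (c i)]
  · have hnull : μ (⋃ i, Metric.sphere (c i) (ε / 2)) = 0 := hμ (measure_iUnion_null fun i =>
      Measure.addHaar_sphere_of_ne_zero _ _ (by positivity))
    refine measure_mono_null (fun x hx => ?_) hnull
    by_contra hs
    refine hx ?_
    classical
    have hex : ∃ i, x ∈ Metric.ball (c i) (ε / 2) := by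
      obtain ⟨i, hy⟩ := (TopologicalSpace.denseRange_denseSeq (Eu n)).exists_mem_open
        (Metric.isOpen_ball (x := x) (ε := ε / 2)) ⟨x, Metric.mem_ball_self (by positivity)⟩
      exact ⟨i, Metric.mem_ball_comm.1 hy⟩
    refine Set.mem_iUnion.2 ⟨Nat.find hex, Nat.find_spec hex, fun hx' => ?_⟩
    simp only [Set.mem_iUnion, Finset.mem_range] at hx'
    obtain ⟨j, hj, hxj⟩ := hx'
    refine Nat.find_min hex hj (Metric.mem_ball.2 (lt_of_le_of_ne (Metric.mem_closedBall.1 hxj) ?_))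
    exact fun he => hs (Set.mem_iUnion.2 ⟨j, he⟩)

/-- If `νs N` converges weakly to `μ`, then eventually `νs N` can be coupled with any variable of
law `μ` so as to be close to it in probability. -/
theorem eventually_exists_coupling {n : ℕ} {μ : Measure (Eu n)} [IsProbabilityMeasure μ]
    (hac : μ ≪ volume) {νs : ℕ → Measure (Eu n)} [∀ N, IsProbabilityMeasure (νs N)]
    (hν : WeakLim νs μ) {ε : ℝ} (hε : 0 < ε) :
    ∀ᶠ N in atTop, ∀ {X : Type} [MeasurableSpace X] (π : Measure X) [IsProbabilityMeasure π]
      (p : X → Eu n), Measurable p → π.map p = μ →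
      ∃ Q : Measure (X × Eu n), Q.map Prod.fst = π ∧ Q.map Prod.snd = νs N ∧
        Q {w | ε ≤ dist (p w.1) w.2} ≤ ENNReal.ofReal ε := by
  obtain ⟨U, hUo, hUd, hUε, hU0⟩ := exists_open_cells hac hε
  have hUm : ∀ i, MeasurableSet (U i) := fun i => (hUo i).measurableSet
  set η : ℝ≥0∞ := ENNReal.ofReal ε / 2 with hη
  have hη0 : η ≠ 0 := by simp [hη, hε]
  have hsum : ∑' i, μ (U i) = 1 := by
    rw [← measure_iUnion hUd hUm, ← prob_compl_eq_zero_iff (MeasurableSet.iUnion hUm)]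
    exact hU0
  have hk : ∃ k : ℕ, 1 - η < ∑ i ∈ Finset.range k, μ (U i) := by
    have := ENNReal.tendsto_nat_tsum fun i => μ (U i)
    rw [hsum] at this
    exact (this.eventually (lt_mem_nhds (ENNReal.sub_lt_self (by simp) (by simp) hη0))).exists
  obtain ⟨k, hk⟩ := hk
  have hev : ∀ᶠ N in atTop, ∀ i ∈ Finset.range k,
      μ (U i) - η / k ≤ νs N (U i) := by
    refine (Finset.eventually_all _).2 fun i hi => ?_
    rcases eq_or_ne (μ (U i)) 0 with h0 | h0
    · simp [h0]
    · have hk0 : η / k ≠ 0 := ENNReal.div_ne_zero.2 ⟨hη0, ENNReal.natCast_ne_top k⟩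
      have hlt : μ (U i) - η / k < liminf (fun N => νs N (U i)) atTop :=
        (ENNReal.sub_lt_self (measure_ne_top _ _) h0 hk0).trans_le
          (hν.le_liminf_measure_open (hUo i))
      exact (eventually_lt_of_lt_liminf hlt).mono fun N hN => hN.le
  filter_upwards [hev] with N hN X _ π _ p hp hpμ
  have hAd : Pairwise (Function.onFun Disjoint fun i => p ⁻¹' U i) := fun i j hij =>
    (hUd hij).preimage p
  obtain ⟨Q, hQ1, hQ2, hQ⟩ := exists_coupling_cells π (νs N) (Finset.range k)
    (fun i => hp (hUm i)) hUm hAd hUd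
  refine ⟨Q, hQ1, hQ2, (measure_mono fun w hw hw' => ?_).trans (hQ.trans ?_)⟩
  · simp only [Set.mem_iUnion] at hw'
    obtain ⟨i, -, hi⟩ := hw'
    exact absurd (hUε i _ hi.1 _ hi.2) (not_lt.2 hw)
  · rw [tsub_le_iff_right]
    have h1 : ∀ i ∈ Finset.range k, μ (U i) ≤
        min (π (p ⁻¹' U i)) (νs N (U i)) + η / k := fun i hi => by
      rw [← Measure.map_apply hp (hUm i), hpμ, min_def]
      split_ifs with h
      · exact le_self_add
      · exact tsub_le_iff_right.1 (hN i hi)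
    have h2 : ∑ i ∈ Finset.range k, (η / k) ≤ η := by
      rw [Finset.sum_const, Finset.card_range, nsmul_eq_mul]
      exact ENNReal.mul_div_le
    calc (1 : ℝ≥0∞) ≤ η + ∑ i ∈ Finset.range k, μ (U i) := by
          rw [add_comm]; exact tsub_le_iff_right.1 hk.le
      _ ≤ η + (∑ i ∈ Finset.range k, min (π (p ⁻¹' U i)) (νs N (U i)) + η) := by
          gcongr
          refine (Finset.sum_le_sum h1).trans ?_
          rw [Finset.sum_add_distrib]
          gcongr
      _ = _ := by
          rw [← add_assoc, add_comm η, add_assoc, ENNReal.add_halves, add_comm]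

/-- A measurable way of moving the endpoints of most curves of finite action while changing the
curve and its action only slightly; the remaining curves are replaced by affine ones. -/
theorem IsTonelli.exists_endpoint_shift (hL : IsTonelli L c₁ c₂ x₀) (hab : a < b)
    (π : Measure (CPath a b n)) [IsProbabilityMeasure π]
    (hfin : ∀ᵐ γ ∂π, action L a b γ ≠ ⊤) {ε : ℝ} (hε : 0 < ε) :
    ∃ (T : CPath a b n × (Eu n × Eu n) → CPath a b n) (G : Set (CPath a b n)) (δ : ℝ),
      Measurable T ∧ MeasurableSet G ∧ 0 < δ ∧ π Gᶜ ≤ ENNReal.ofReal ε ∧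
      (∀ w, pev (T w) a = w.2.1 ∧ pev (T w) b = w.2.2) ∧
      (∀ w, w.1 ∈ G → dist (pev w.1 a) w.2.1 < δ → dist (pev w.1 b) w.2.2 < δ →
        dist w.1 (T w) < ε ∧ action L a b (T w) ≤ action L a b w.1 + (ε : EReal)) ∧
      ∀ w, ¬ (w.1 ∈ G ∧ dist (pev w.1 a) w.2.1 < δ ∧ dist (pev w.1 b) w.2.2 < δ) →
        T w = affPath a b w.2 := by
  classical
  have hloc : ∀ γ : {γ : CPath a b n // action L a b γ ≠ ⊤}, ∃ (V : Set (CPath a b n))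
      (F : Eu n × Eu n → CPath a b n) (δ : ℝ), IsOpen V ∧ γ.1 ∈ V ∧ Continuous F ∧ 0 < δ ∧
      (∀ z, pev (F z) a = z.1 ∧ pev (F z) b = z.2) ∧
      ∀ η ∈ V, ∀ z : Eu n × Eu n, dist (pev η a) z.1 < δ → dist (pev η b) z.2 < δ →
        dist η (F z) < ε ∧ action L a b (F z) ≤ action L a b η + (ε : EReal) := by
    rintro ⟨γ, hγ⟩
    obtain ⟨γ', δ, hδ, hγa, hγb, hpert⟩ := hL.exists_perturbable hab hγ (half_pos hε)
    have hlt : action L a b γ - ((ε / 2 : ℝ) : EReal) < action L a b γ := by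
      lift action L a b γ to ℝ using ⟨hγ, action_ne_bot⟩ with A
      rw [← EReal.coe_sub, EReal.coe_lt_coe_iff]
      linarith
    refine ⟨{η | action L a b γ - ((ε / 2 : ℝ) : EReal) < action L a b η} ∩
        Metric.ball γ (min (δ / 2) (ε / 2)),
      fun z => γ' + affPath a b (z - (pev γ a, pev γ b)), δ / 2,
      ((hL.lowerSemicontinuous_action hab).isOpen_preimage _).inter Metric.isOpen_ball,
      ⟨hlt, Metric.mem_ball_self (by positivity)⟩,
      continuous_const.add (continuous_affPath.comp (continuous_id.sub continuous_const)),
      half_pos hδ, fun z => ⟨?_, ?_⟩, fun η hη z hza hzb => ?_⟩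
    · rw [pev_add, pev_affPath_left hab, hγa]
      simp
    · rw [pev_add, pev_affPath_right hab, hγb]
      simp
    · have hd := lt_min_iff.1 (Metric.mem_ball.1 hη.2)
      have hz : ‖z - (pev γ a, pev γ b)‖ < δ := by
        rw [← dist_eq_norm, Prod.dist_eq]
        refine max_lt ?_ ?_
        · have h1 := norm_pev_sub_le η γ a
          rw [← dist_eq_norm] at h1
          change dist z.1 (pev γ a) < δ
          linarith [dist_triangle_left z.1 (pev γ a) (pev η a), hd.1]
        · have h1 := norm_pev_sub_le η γ b
          rw [← dist_eq_norm] at h1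
          change dist z.2 (pev γ b) < δ
          linarith [dist_triangle_left z.2 (pev γ b) (pev η b), hd.1]
      obtain ⟨h1, h2⟩ := hpert _ hz
      refine ⟨by linarith [dist_triangle_right η (γ' + affPath a b (z - (pev γ a, pev γ b))) γ, hd.2],
        h2.trans ?_⟩
      have h3 : action L a b γ - ((ε / 2 : ℝ) : EReal) < action L a b η := hη.1
      lift action L a b γ to ℝ using ⟨hγ, action_ne_bot⟩ with A
      generalize action L a b η = y at h3 ⊢
      induction y with
      | bot => exact absurd h3 not_lt_bot
      | top => simp
      | coe r =>
        norm_cast at h3 ⊢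
        linarith
  choose V F δ hVo hmem hF hδ hend hclose using hloc
  obtain ⟨I, hIc, hI⟩ := TopologicalSpace.isOpen_iUnion_countable V hVo
  have hcov : ∀ᵐ γ ∂π, γ ∈ ⋃ i ∈ I, V i := hfin.mono fun γ hγ => by
    rw [hI]
    exact Set.mem_iUnion.2 ⟨⟨γ, hγ⟩, hmem _⟩
  have hIne : I.Nonempty := by
    obtain ⟨γ, hγ⟩ := hcov.exists
    simp only [Set.mem_iUnion] at hγ
    exact ⟨hγ.choose, hγ.choose_spec.choose⟩
  obtain ⟨e, rfl⟩ := hIc.exists_eq_range hIne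
  rw [Set.biUnion_range] at hcov
  set W : ℕ → Set (CPath a b n) := fun k => ⋃ i ∈ Finset.range k, V (e i) with hW
  have hWo : ∀ k, IsOpen (W k) := fun k => isOpen_biUnion fun i _ => hVo _
  have hWlim : Tendsto (fun k => π (W k)ᶜ) atTop (𝓝 0) := by
    have h0 : π (⋂ k, (W k)ᶜ) = 0 := by
      refine measure_mono_null (fun γ hγ => ?_) (ae_iff.1 hcov)
      rw [Set.mem_ofPred_eq]
      intro hγ'
      obtain ⟨i, hi⟩ := Set.mem_iUnion.1 hγ'
      exact Set.mem_iInter.1 hγ (i + 1) (Set.mem_biUnion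
        (Finset.mem_coe.2 (Finset.mem_range.2 i.lt_succ_self)) hi)
    rw [← h0]
    refine tendsto_measure_iInter_atTop (fun k => (hWo k).measurableSet.compl.nullMeasurableSet)
      (fun i j hij => Set.compl_subset_compl.2 (Set.biUnion_subset_biUnion_left ?_))
      ⟨0, measure_ne_top _ _⟩
    exact Finset.coe_subset.2 (Finset.range_subset_range.2 hij)
  obtain ⟨k, hk⟩ := (hWlim.eventually (ge_mem_nhds (ENNReal.ofReal_pos.2 hε))).exists
  obtain ⟨δ₀, hδ₀, hδ₀le⟩ : ∃ δ₀ : ℝ, 0 < δ₀ ∧ ∀ i < k, δ₀ ≤ δ (e i) := by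
    clear_value W
    clear hk
    induction k with
    | zero => exact ⟨1, one_pos, by simp⟩
    | succ k ih =>
      obtain ⟨d, hd, hdle⟩ := ih
      refine ⟨min d (δ (e k)), lt_min hd (hδ _), fun i hi => ?_⟩
      rcases Nat.lt_succ_iff_lt_or_eq.1 hi with h | rfl
      · exact (min_le_left _ _).trans (hdle i h)
      · exact min_le_right _ _
  have hex : ∀ η : CPath a b n, ∃ i, η ∈ V (e i) ∨ k ≤ i := fun η => ⟨k, Or.inr le_rfl⟩
  have hfind : Measurable fun η => Nat.find (hex η) := measurable_find hex fun i =>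
    (hVo (e i)).measurableSet.union (MeasurableSet.const (k ≤ i))
  have hfindW : ∀ η ∈ W k, Nat.find (hex η) < k ∧ η ∈ V (e (Nat.find (hex η))) := fun η hη => by
    simp only [hW, Set.mem_iUnion, Finset.mem_range] at hη
    obtain ⟨i, hi, hηi⟩ := hη
    have hlt : Nat.find (hex η) < k := (Nat.find_min' (hex η) (Or.inl hηi)).trans_lt hi
    exact ⟨hlt, (Nat.find_spec (hex η)).resolve_right (not_le.2 hlt)⟩
  set D : Set (CPath a b n × (Eu n × Eu n)) :=
    {w | w.1 ∈ W k ∧ dist (pev w.1 a) w.2.1 < δ₀ ∧ dist (pev w.1 b) w.2.2 < δ₀} with hD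
  have hDm : MeasurableSet D := by
    refine ((hWo k).measurableSet.preimage measurable_fst).inter (MeasurableSet.inter ?_ ?_)
    · exact measurableSet_lt (((measurable_pev a).comp measurable_fst).dist
        (measurable_fst.comp measurable_snd)) measurable_const
    · exact measurableSet_lt (((measurable_pev b).comp measurable_fst).dist
        (measurable_snd.comp measurable_snd)) measurable_const
  have hFm : Measurable fun w : CPath a b n × (Eu n × Eu n) => F (e (Nat.find (hex w.1))) w.2 := by
    have h1 : Measurable fun q : ℕ × (Eu n × Eu n) => F (e q.1) q.2 :=
      measurable_from_prod_countable_right fun i => (hF (e i)).measurable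
    exact h1.comp ((hfind.comp measurable_fst).prodMk measurable_snd)
  refine ⟨fun w => if w ∈ D then F (e (Nat.find (hex w.1))) w.2 else affPath a b w.2, W k, δ₀,
    Measurable.ite hDm hFm (continuous_affPath.measurable.comp measurable_snd),
    (hWo k).measurableSet, hδ₀, hk, fun w => ?_, fun w hw hwa hwb => ?_, fun w hw => ?_⟩
  · dsimp only
    split_ifs
    · exact hend _ _
    · exact ⟨pev_affPath_left hab _, pev_affPath_right hab _⟩
  · dsimp only
    rw [if_pos ⟨hw, hwa, hwb⟩]
    obtain ⟨h1, h2⟩ := hfindW _ hw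
    exact hclose _ _ h2 _ (hwa.trans_le (hδ₀le _ h1)) (hwb.trans_le (hδ₀le _ h1))
  · exact if_neg hw

theorem isProbabilityMeasure_of_map_eq {X Y : Type*} [MeasurableSpace X] [MeasurableSpace Y]
    {Q : Measure X} {π : Measure Y} [IsProbabilityMeasure π] {f : X → Y} (hf : Measurable f)
    (h : Q.map f = π) : IsProbabilityMeasure Q :=
  ⟨by rw [← measure_univ (μ := π), ← h, Measure.map_apply hf MeasurableSet.univ, Set.preimage_univ]⟩

/-- A law on curves can be coupled simultaneously with approximations of both endpoint laws. -/
theorem eventually_exists_endpoint_coupling {π : Measure (CPath a b n)} [IsProbabilityMeasure π]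
    (haca : π.map (fun γ => pev γ a) ≪ volume) (hacb : π.map (fun γ => pev γ b) ≪ volume)
    {νa νb : ℕ → Measure (Eu n)} [∀ N, IsProbabilityMeasure (νa N)]
    [∀ N, IsProbabilityMeasure (νb N)] (ha : WeakLim νa (π.map fun γ => pev γ a))
    (hb : WeakLim νb (π.map fun γ => pev γ b)) {ε : ℝ} (hε : 0 < ε) :
    ∀ᶠ N in atTop, ∃ Q : Measure (CPath a b n × (Eu n × Eu n)), Q.map Prod.fst = π ∧
      Q.map (fun w => w.2.1) = νa N ∧ Q.map (fun w => w.2.2) = νb N ∧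
      Q {w | ε ≤ dist (pev w.1 a) w.2.1} ≤ ENNReal.ofReal ε ∧
      Q {w | ε ≤ dist (pev w.1 b) w.2.2} ≤ ENNReal.ofReal ε := by
  have hpa : IsProbabilityMeasure (π.map fun γ => pev γ a) :=
    Measure.isProbabilityMeasure_map (measurable_pev a).aemeasurable
  have hpb : IsProbabilityMeasure (π.map fun γ => pev γ b) :=
    Measure.isProbabilityMeasure_map (measurable_pev b).aemeasurable
  filter_upwards [eventually_exists_coupling haca ha hε, eventually_exists_coupling hacb hb hε]
    with N hNa hNb
  obtain ⟨Q, hQ1, hQ2, hQ⟩ := hNa π _ (measurable_pev a) rfl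
  have hQp : IsProbabilityMeasure Q := isProbabilityMeasure_of_map_eq measurable_fst hQ1
  have hm : Measurable fun w : CPath a b n × Eu n => pev w.1 b :=
    (measurable_pev b).comp measurable_fst
  obtain ⟨P, hP1, hP2, hP⟩ := hNb Q (fun w => pev w.1 b) hm (by
    rw [← hQ1, Measure.map_map (measurable_pev b) measurable_fst]
    rfl)
  have hσ : Measurable fun w : (CPath a b n × Eu n) × Eu n => (w.1.1, (w.1.2, w.2)) := by fun_prop
  have hma : Measurable fun w : CPath a b n × (Eu n × Eu n) => dist (pev w.1 a) w.2.1 :=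
    ((measurable_pev a).comp measurable_fst).dist (measurable_fst.comp measurable_snd)
  have hma' : Measurable fun w : CPath a b n × Eu n => dist (pev w.1 a) w.2 :=
    ((measurable_pev a).comp measurable_fst).dist measurable_snd
  have hmb : Measurable fun w : CPath a b n × (Eu n × Eu n) => dist (pev w.1 b) w.2.2 :=
    ((measurable_pev b).comp measurable_fst).dist (measurable_snd.comp measurable_snd)
  refine ⟨P.map fun w => (w.1.1, (w.1.2, w.2)), ?_, ?_, ?_, ?_, ?_⟩
  · rw [Measure.map_map measurable_fst hσ, ← hQ1, ← hP1, Measure.map_map measurable_fst measurable_fst]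
    rfl
  · rw [Measure.map_map (by fun_prop) hσ, ← hQ2, ← hP1, Measure.map_map measurable_snd measurable_fst]
    rfl
  · rw [Measure.map_map (by fun_prop) hσ, ← hP2]
    rfl
  · rw [Measure.map_apply hσ (measurableSet_le measurable_const hma)]
    refine le_trans (le_of_eq ?_) hQ
    rw [← hP1, Measure.map_apply measurable_fst (measurableSet_le measurable_const hma')]
    rfl
  · rw [Measure.map_apply hσ (measurableSet_le measurable_const hmb)]
    exact hP

/-- Approximate recovery: laws with prescribed nearby endpoint distributions, close to a given law
on curves and with almost the same action. -/
theorem IsTonelli.eventually_exists_recovery (hL : IsTonelli L c₁ c₂ x₀) (hab : a < b)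
    (htime : b - a ≤ Real.sqrt (c₁ / (4 * c₂))) {π : Measure (CPath a b n)}
    [IsProbabilityMeasure π]
    (haca : π.map (fun γ => pev γ a) ≪ volume) (hacb : π.map (fun γ => pev γ b) ≪ volume)
    {νa νb : ℕ → Measure (Eu n)} [∀ N, IsProbabilityMeasure (νa N)]
    [∀ N, IsProbabilityMeasure (νb N)] (ha : WeakLim νa (π.map fun γ => pev γ a))
    (hb : WeakLim νb (π.map fun γ => pev γ b)) {K : Set (Eu n)} (hK : IsCompact K)
    (hπK : ∀ᵐ γ ∂π, pev γ a ∈ K) (hνa : ∀ N, ∀ᵐ x ∂νa N, x ∈ K) (hνb : ∀ N, ∀ᵐ x ∂νb N, x ∈ K)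
    (hfin : mint (action L a b) π ≠ ⊤) {ε : ℝ} (hε : 0 < ε) :
    ∀ᶠ N in atTop, ∃ Q : Measure (CPath a b n × CPath a b n), Q.map Prod.fst = π ∧
      (Q.map Prod.snd).map (fun γ => pev γ a) = νa N ∧
      (Q.map Prod.snd).map (fun γ => pev γ b) = νb N ∧
      Q {w | ε ≤ dist w.1 w.2} ≤ ENNReal.ofReal ε ∧
      mint (action L a b) (Q.map Prod.snd) ≤ mint (action L a b) π + (ε : EReal) := by
  have hAm : Measurable (action L a b (n := n)) := (hL.lowerSemicontinuous_action hab).measurable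
  obtain ⟨R, hR⟩ := hK.isBounded.subset_closedBall x₀
  obtain ⟨M, hM⟩ := hL.exists_neg_le_action hab htime R
  have hMK : ∀ γ : CPath a b n, pev γ a ∈ K → (((-(M : ℝ)) : ℝ) : EReal) ≤ action L a b γ :=
    fun γ hγ => hM γ (by rw [← dist_eq_norm]; exact hR hγ)
  obtain ⟨C, hC⟩ := hL.exists_action_affPath_le hab hK
  set F : CPath a b n → ℝ≥0∞ := fun γ => (action L a b γ + ((M : ℝ) : EReal)).toENNReal with hF
  have hFm : Measurable F := (hAm.add measurable_const).ereal_toENNReal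
  have hπint := mint_eq_lintegral_sub hAm π M (hπK.mono hMK)
  have hFfin : ∫⁻ γ, F γ ∂π ≠ ⊤ := fun h => hfin (by rw [hπint, h]; simp)
  have hfinae : ∀ᵐ γ ∂π, action L a b γ ≠ ⊤ := by
    filter_upwards [ae_lt_top hFm hFfin] with γ hγ h
    simp [hF, h] at hγ
  set D : ℝ := max (C + M) 0 with hD
  have hD0 : 0 ≤ D := le_max_right _ _
  obtain ⟨κ, hκ, hκ1, hκ2⟩ : ∃ κ : ℝ, 0 < κ ∧ 3 * κ ≤ ε ∧ κ + D * (3 * κ) ≤ ε := by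
    refine ⟨ε / (3 * (1 + D)), by positivity, ?_, ?_⟩
    · rw [← mul_div_assoc, div_le_iff₀ (by positivity)]
      nlinarith
    · rw [show ε / (3 * (1 + D)) + D * (3 * (ε / (3 * (1 + D)))) = ε * (1 / 3 + D) / (1 + D) by
        field_simp, div_le_iff₀ (by positivity)]
      nlinarith
  obtain ⟨T, G, δ, hTm, hGm, hδ, hπG, hTend, hTgood, hTbad⟩ :=
    hL.exists_endpoint_shift hab π hfinae hκ
  filter_upwards [eventually_exists_endpoint_coupling haca hacb ha hb (lt_min hδ hκ)] with N hN
  obtain ⟨Q, hQ, hQa, hQb, hQda, hQdb⟩ := hN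
  have hQp : IsProbabilityMeasure Q := isProbabilityMeasure_of_map_eq measurable_fst hQ
  set B : Set (CPath a b n × (Eu n × Eu n)) :=
    {w | w.1 ∈ G ∧ dist (pev w.1 a) w.2.1 < δ ∧ dist (pev w.1 b) w.2.2 < δ}ᶜ with hB
  have hBm : MeasurableSet B := by
    refine ((hGm.preimage measurable_fst).inter (MeasurableSet.inter ?_ ?_)).compl
    · exact measurableSet_lt (((measurable_pev a).comp measurable_fst).dist
        (measurable_fst.comp measurable_snd)) measurable_const
    · exact measurableSet_lt (((measurable_pev b).comp measurable_fst).dist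
        (measurable_snd.comp measurable_snd)) measurable_const
  have hQB : Q B ≤ ENNReal.ofReal (3 * κ) := by
    have h1 : Q (Prod.fst ⁻¹' Gᶜ) ≤ ENNReal.ofReal κ := by
      rwa [← Measure.map_apply measurable_fst hGm.compl, hQ]
    have hsub : B ⊆ Prod.fst ⁻¹' Gᶜ ∪ ({w | min δ κ ≤ dist (pev w.1 a) w.2.1} ∪
        {w | min δ κ ≤ dist (pev w.1 b) w.2.2}) := by
      intro w hw
      by_contra hc
      simp only [Set.mem_union, Set.mem_preimage, Set.mem_compl_iff, Set.mem_ofPred_eq, not_or,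
        not_not, not_le] at hc
      exact hw ⟨hc.1, hc.2.1.trans_le (min_le_left _ _), hc.2.2.trans_le (min_le_left _ _)⟩
    have hmin : ENNReal.ofReal (min δ κ) ≤ ENNReal.ofReal κ :=
      ENNReal.ofReal_le_ofReal (min_le_right _ _)
    calc Q B ≤ ENNReal.ofReal κ + (ENNReal.ofReal κ + ENNReal.ofReal κ) :=
          (measure_mono hsub).trans ((measure_union_le _ _).trans (add_le_add h1
            ((measure_union_le _ _).trans (add_le_add (hQda.trans hmin) (hQdb.trans hmin)))))
      _ = ENNReal.ofReal (3 * κ) := by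
          rw [← ENNReal.ofReal_add hκ.le hκ.le, ← ENNReal.ofReal_add hκ.le (by positivity)]
          congr 1
          ring
  have hΦ : Measurable fun w : CPath a b n × (Eu n × Eu n) => (w.1, T w) :=
    measurable_fst.prodMk hTm
  have hsnd : (Q.map fun w => (w.1, T w)).map Prod.snd = Q.map T :=
    Measure.map_map measurable_snd hΦ
  have hKa : ∀ᵐ w ∂Q, w.2.1 ∈ K := ae_of_ae_map
    (f := fun w : CPath a b n × (Eu n × Eu n) => w.2.1) (by fun_prop) (hQa ▸ hνa N)
  have hKb : ∀ᵐ w ∂Q, w.2.2 ∈ K := ae_of_ae_map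
    (f := fun w : CPath a b n × (Eu n × Eu n) => w.2.2) (by fun_prop) (hQb ▸ hνb N)
  refine ⟨Q.map fun w => (w.1, T w), ?_, ?_, ?_, ?_, ?_⟩
  · rw [Measure.map_map measurable_fst hΦ]
    exact hQ
  · rw [hsnd, Measure.map_map (measurable_pev a) hTm, ← hQa]
    exact congrArg (Measure.map · Q) (funext fun w => (hTend w).1)
  · rw [hsnd, Measure.map_map (measurable_pev b) hTm, ← hQb]
    exact congrArg (Measure.map · Q) (funext fun w => (hTend w).2)
  · rw [Measure.map_apply hΦ (measurableSet_le measurable_const measurable_dist)]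
    refine (measure_mono fun w hw => ?_).trans (hQB.trans (ENNReal.ofReal_le_ofReal hκ1))
    intro hc
    have h1 := (hTgood w hc.1 hc.2.1 hc.2.2).1
    have h2 : ε ≤ dist w.1 (T w) := hw
    linarith
  · rw [hsnd]
    have hTp : IsProbabilityMeasure (Q.map T) := Measure.isProbabilityMeasure_map hTm.aemeasurable
    have hTlow : ∀ᵐ γ ∂Q.map T, (((-(M : ℝ)) : ℝ) : EReal) ≤ action L a b γ := by
      refine (ae_map_iff hTm.aemeasurable (measurableSet_le measurable_const hAm)).2 ?_
      filter_upwards [hKa] with w hw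
      exact hMK _ (by rwa [(hTend w).1])
    have hle : ∫⁻ γ, F γ ∂Q.map T ≤ ∫⁻ γ, F γ ∂π + ENNReal.ofReal ε := by
      calc ∫⁻ γ, F γ ∂Q.map T = ∫⁻ w, F (T w) ∂Q := lintegral_map hFm hTm
        _ ≤ ∫⁻ w, (F w.1 + ENNReal.ofReal κ + B.indicator (fun _ => ENNReal.ofReal D) w) ∂Q := by
            refine lintegral_mono_ae ?_
            filter_upwards [hKa, hKb] with w hwa hwb
            by_cases hw : w ∈ B
            · rw [Set.indicator_of_mem hw, hTbad w hw]
              refine le_trans ?_ le_add_self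
              have h1 : action L a b (affPath a b w.2) + ((M : ℝ) : EReal) ≤ ((C + M : ℝ) : EReal) := by
                rw [EReal.coe_add]
                exact add_le_add_left (hC _ hwa _ hwb) _
              refine (EReal.toENNReal_le_toENNReal h1).trans ?_
              rw [EReal.real_coe_toENNReal]
              exact ENNReal.ofReal_le_ofReal (le_max_left _ _)
            · rw [Set.indicator_of_notMem hw, add_zero]
              obtain ⟨h1, h2, h3⟩ := not_not.1 hw
              have h4 := (hTgood w h1 h2 h3).2
              calc F (T w) ≤ (action L a b w.1 + ((M : ℝ) : EReal) + (κ : EReal)).toENNReal := by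
                    refine EReal.toENNReal_le_toENNReal ?_
                    rw [add_right_comm]
                    exact add_le_add_left h4 _
                _ ≤ F w.1 + (κ : EReal).toENNReal := EReal.toENNReal_add_le
                _ = _ := by rw [EReal.real_coe_toENNReal]
        _ = ∫⁻ γ, F γ ∂π + ENNReal.ofReal κ + ENNReal.ofReal D * Q B := by
            rw [lintegral_add_right _ (measurable_const.indicator hBm),
              lintegral_add_right _ measurable_const, lintegral_indicator_const hBm,
              lintegral_const, measure_univ, mul_one, ← hQ, lintegral_map hFm measurable_fst]
        _ ≤ ∫⁻ γ, F γ ∂π + ENNReal.ofReal κ + ENNReal.ofReal D * ENNReal.ofReal (3 * κ) := by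
            gcongr
        _ ≤ _ := by
            rw [← ENNReal.ofReal_mul hD0, add_assoc, ← ENNReal.ofReal_add hκ.le (by positivity)]
            gcongr
    rw [mint_eq_lintegral_sub hAm (Q.map T) M hTlow, hπint]
    change ((∫⁻ γ, F γ ∂Q.map T : ℝ≥0∞) : EReal) - _ ≤ ((∫⁻ γ, F γ ∂π : ℝ≥0∞) : EReal) - _ + _
    have h1 : ((∫⁻ γ, F γ ∂Q.map T : ℝ≥0∞) : EReal) ≤ ((∫⁻ γ, F γ ∂π : ℝ≥0∞) : EReal) + (ε : EReal) := by
      refine (EReal.coe_ennreal_le_coe_ennreal_iff.2 hle).trans_eq ?_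
      rw [EReal.coe_ennreal_add, EReal.coe_ennreal_ofReal, max_eq_left hε.le]
    refine (EReal.sub_le_sub h1 le_rfl).trans_eq ?_
    rw [sub_eq_add_neg, sub_eq_add_neg, add_right_comm]

theorem exists_diagonal_seq {α : Type*} [Nonempty α] {P : ℕ → ℕ → α → Prop}
    (hP : ∀ {j k : ℕ} (N : ℕ) (q : α), j ≤ k → P k N q → P j N q)
    (h : ∀ k, ∀ᶠ N in atTop, ∃ q, P k N q) : ∃ q : ℕ → α, ∀ k, ∀ᶠ N in atTop, P k N (q N) := by
  classical
  set m : ℕ → ℕ := fun N => Nat.findGreatest (fun k => ∃ q, P k N q) N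
  have hq : ∀ N, ∃ q, (∃ q', P (m N) N q') → P (m N) N q := fun N => by
    by_cases h : ∃ q', P (m N) N q'
    · exact ⟨h.choose, fun _ => h.choose_spec⟩
    · exact ⟨Classical.arbitrary α, fun h' => absurd h' h⟩
  choose q hq using hq
  refine ⟨q, fun k => ?_⟩
  filter_upwards [h k, eventually_ge_atTop k] with N hN hk
  exact hP N _ (Nat.le_findGreatest hk hN)
    (hq N (Nat.findGreatest_spec (P := fun k => ∃ q, P k N q) hk hN))

/-- Convergence in probability of couplings implies weak convergence. -/
theorem weakLim_of_coupling {X : Type*} [PseudoMetricSpace X] [SecondCountableTopology X]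
    [MeasurableSpace X] [BorelSpace X] {π : Measure X} [hπ : IsProbabilityMeasure π]
    {Q : ℕ → Measure (X × X)} (hQ : ∀ N, (Q N).map Prod.fst = π)
    (hd : ∀ ε : ℝ, 0 < ε → ∀ᶠ N in atTop, Q N {w | ε ≤ dist w.1 w.2} ≤ ENNReal.ofReal ε) :
    WeakLim (fun N => (Q N).map Prod.snd) π := by
  have hQp : ∀ N, IsProbabilityMeasure (Q N) := fun N =>
    isProbabilityMeasure_of_map_eq measurable_fst (hQ N)
  let P : ℕ → ProbabilityMeasure X := fun N =>
    ⟨(Q N).map Prod.snd, Measure.isProbabilityMeasure_map measurable_snd.aemeasurable⟩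
  let P' : ProbabilityMeasure X := ⟨π, hπ⟩
  refine (ProbabilityMeasure.tendsto_iff_forall_integral_tendsto (μs := P) (μ := P')).1 ?_
  refine tendsto_iff_forall_lipschitz_integral_tendsto.2 ?_
  rintro f ⟨C, hC⟩ ⟨l, hl⟩
  change Tendsto (fun N => ∫ x, f x ∂(Q N).map Prod.snd) atTop (𝓝 (∫ x, f x ∂π))
  have hfm : StronglyMeasurable f := hl.continuous.stronglyMeasurable
  obtain ⟨z⟩ : Nonempty X := nonempty_of_isProbabilityMeasure π
  have hC0 : 0 ≤ C := dist_nonneg.trans (hC z z)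
  have hint : ∀ N (g : X × X → X), Measurable g → Integrable (fun w => f (g w)) (Q N) := fun N g hg =>
    Integrable.of_bound (hfm.comp_measurable hg).aestronglyMeasurable (C + ‖f z‖)
      (ae_of_all _ fun w => by
        have := hC (g w) z
        rw [dist_eq_norm] at this
        linarith [norm_sub_norm_le (f (g w)) (f z)])
  rw [Metric.tendsto_nhds]
  intro η hη
  set ε : ℝ := η / (l + C + 1) with hε
  have hpos : 0 < (l : ℝ) + C + 1 := by have := l.coe_nonneg; positivity
  have hε0 : 0 < ε := by positivity
  filter_upwards [hd ε hε0] with N hN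
  have h1 : ∫ x, f x ∂(Q N).map Prod.snd = ∫ w, f w.2 ∂Q N :=
    integral_map_of_stronglyMeasurable measurable_snd hfm
  have h2 : ∫ x, f x ∂π = ∫ w, f w.1 ∂Q N := by
    rw [← hQ N]
    exact integral_map_of_stronglyMeasurable measurable_fst hfm
  have hm : MeasurableSet {w : X × X | ε ≤ dist w.1 w.2} :=
    measurableSet_le measurable_const measurable_dist
  rw [h1, h2, dist_eq_norm, ← integral_sub (hint N _ measurable_snd) (hint N _ measurable_fst)]
  have hint2 : Integrable (fun w => (l : ℝ) * ε +
      {w : X × X | ε ≤ dist w.1 w.2}.indicator (fun _ => C) w) (Q N) :=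
    (integrable_const _).add ((integrable_const C).indicator hm)
  have hle := norm_integral_le_of_norm_le hint2 (f := fun w => f w.2 - f w.1)
    (ae_of_all _ fun w => by
      by_cases hw : ε ≤ dist w.1 w.2
      · rw [Set.indicator_of_mem (by exact hw), ← dist_eq_norm]
        have := l.coe_nonneg
        nlinarith [hC w.2 w.1]
      · rw [Set.indicator_of_notMem (by exact hw), add_zero, ← dist_eq_norm]
        refine (hl.dist_le_mul _ _).trans ?_
        rw [dist_comm]
        exact mul_le_mul_of_nonneg_left (not_le.1 hw).le l.coe_nonneg)
  refine hle.trans_lt ?_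
  rw [integral_add (integrable_const _) ((integrable_const C).indicator hm), integral_const,
    integral_indicator_const _ hm, probReal_univ, one_smul, smul_eq_mul]
  have h3 : (Q N).real {w | ε ≤ dist w.1 w.2} ≤ ε :=
    ENNReal.toReal_le_of_le_ofReal hε0.le hN
  have h4 : ε * (l + C + 1) = η := div_mul_cancel₀ _ hpos.ne'
  nlinarith

/-- Existence of recovery sequences for the constrained action functionals. -/
theorem IsTonelli.exists_recovery_seq (hL : IsTonelli L c₁ c₂ x₀) (hab : a < b)
    (htime : b - a ≤ Real.sqrt (c₁ / (4 * c₂))) {μa μb : Measure (Eu n)} [IsProbabilityMeasure μa]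
    [IsProbabilityMeasure μb] (haca : μa ≪ volume) (hacb : μb ≪ volume)
    {νa νb : ℕ → Measure (Eu n)} [∀ N, IsProbabilityMeasure (νa N)]
    [∀ N, IsProbabilityMeasure (νb N)] (ha : WeakLim νa μa) (hb : WeakLim νb μb)
    {K : Set (Eu n)} (hK : IsCompact K) (hμa : ∀ᵐ x ∂μa, x ∈ K)
    (hνa : ∀ N, ∀ᵐ x ∂νa N, x ∈ K) (hνb : ∀ N, ∀ᵐ x ∂νb N, x ∈ K)
    (π : Measure (CPath a b n)) [IsProbabilityMeasure π] :
    ∃ πs : ℕ → Measure (CPath a b n), (∀ N, IsProbabilityMeasure (πs N)) ∧ WeakLim πs π ∧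
      Tendsto (fun N => aFun (action L a b) (νa N) (νb N) (πs N)) atTop
        (𝓝 (aFun (action L a b) μa μb π)) := by
  obtain ⟨R, hR⟩ := hK.isBounded.subset_closedBall x₀
  have hKR : ∀ x ∈ K, ‖x - x₀‖ ≤ R := fun x hx => by
    rw [← dist_eq_norm]
    exact hR hx
  have hlow : ∀ πs : ℕ → Measure (CPath a b n), (∀ N, IsProbabilityMeasure (πs N)) →
      WeakLim πs π → aFun (action L a b) μa μb π ≤
        liminf (fun N => aFun (action L a b) (νa N) (νb N) (πs N)) atTop := fun πs _ hw =>
    hL.aFun_le_liminf hab htime ha hb (hμa.mono hKR) (fun N => (hνa N).mono hKR) hw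
  rcases eq_or_ne (aFun (action L a b) μa μb π) ⊤ with htop | htop
  · have hw : WeakLim (fun _ => π) π := fun φ => tendsto_const_nhds
    refine ⟨fun _ => π, fun _ => ‹_›, hw, ?_⟩
    exact tendsto_of_le_liminf_of_limsup_le (hlow _ (fun _ => ‹_›) hw) (by rw [htop]; exact le_top)
  · by_cases hmarg : π.map (fun γ => pev γ a) = μa ∧ π.map (fun γ => pev γ b) = μb
    swap
    · exact absurd (by rw [aFun, if_neg hmarg]) htop
    obtain ⟨rfl, rfl⟩ := hmarg
    have hmint : aFun (action L a b) (π.map fun γ => pev γ a) (π.map fun γ => pev γ b) π =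
        mint (action L a b) π := if_pos ⟨rfl, rfl⟩
    rw [hmint] at htop hlow ⊢
    have hπK : ∀ᵐ γ ∂π, pev γ a ∈ K := ae_of_ae_map (measurable_pev a).aemeasurable hμa
    have hbot : mint (action L a b) π ≠ ⊥ := by
      obtain ⟨M, hM⟩ := hL.exists_neg_le_action hab htime R
      rw [mint_eq_lintegral_sub (hL.lowerSemicontinuous_action hab).measurable π M
        (hπK.mono fun γ hγ => hM γ (hKR _ hγ)), sub_eq_add_neg, ← EReal.coe_neg]
      simp
    have : Nonempty {Q : Measure (CPath a b n × CPath a b n) // Q.map Prod.fst = π} := by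
      refine ⟨⟨π.map fun γ => (γ, γ), ?_⟩⟩
      rw [Measure.map_map measurable_fst (by fun_prop)]
      exact Measure.map_id
    set e : ℕ → ℝ := fun k => 1 / ((k : ℝ) + 1) with he
    have he0 : ∀ k, 0 < e k := fun k => Nat.one_div_pos_of_nat
    have hrec := fun k => hL.eventually_exists_recovery hab htime haca hacb ha hb hK hπK hνa hνb
      htop (he0 k)
    obtain ⟨q, hq⟩ := exists_diagonal_seq
      (α := {Q : Measure (CPath a b n × CPath a b n) // Q.map Prod.fst = π})
      (P := fun k N Q => (Q.1.map Prod.snd).map (fun γ => pev γ a) = νa N ∧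
        (Q.1.map Prod.snd).map (fun γ => pev γ b) = νb N ∧
        Q.1 {w | e k ≤ dist w.1 w.2} ≤ ENNReal.ofReal (e k) ∧
        mint (action L a b) (Q.1.map Prod.snd) ≤ mint (action L a b) π + (e k : EReal))
      (fun {j k} N Q hjk h => by
        have hle : e k ≤ e j := Nat.one_div_le_one_div hjk
        refine ⟨h.1, h.2.1, (measure_mono fun w hw => hle.trans hw).trans
          (h.2.2.1.trans (ENNReal.ofReal_le_ofReal hle)), h.2.2.2.trans ?_⟩
        gcongr)
      (fun k => (hrec k).mono fun N ⟨Q, h, h'⟩ => ⟨⟨Q, h⟩, h'⟩)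
    have hqp : ∀ N, IsProbabilityMeasure ((q N).1.map Prod.snd) := fun N =>
      have := isProbabilityMeasure_of_map_eq measurable_fst (q N).2
      Measure.isProbabilityMeasure_map measurable_snd.aemeasurable
    have hw : WeakLim (fun N => (q N).1.map Prod.snd) π := by
      refine weakLim_of_coupling (fun N => (q N).2) fun ε hε => ?_
      obtain ⟨k, hk⟩ := exists_nat_one_div_lt hε
      filter_upwards [hq k] with N hN
      exact (measure_mono fun w hw => hk.le.trans hw).trans
        (hN.2.2.1.trans (ENNReal.ofReal_le_ofReal hk.le))
    refine ⟨_, hqp, hw, tendsto_of_le_liminf_of_limsup_le (hlow _ hqp hw) ?_⟩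
    have hsup : ∀ k, limsup (fun N => aFun (action L a b) (νa N) (νb N) ((q N).1.map Prod.snd)) atTop ≤
        mint (action L a b) π + (e k : EReal) := fun k => by
      refine limsup_le_of_le (by isBoundedDefault) ((hq k).mono fun N hN => ?_)
      rw [aFun, if_pos ⟨hN.1, hN.2.1⟩]
      exact hN.2.2.2
    lift mint (action L a b) π to ℝ using ⟨htop, hbot⟩ with r
    refine ge_of_tendsto' (x := atTop) (f := fun k => (r : EReal) + (e k : EReal)) ?_ hsup
    have h1 : Tendsto (fun k => r + e k) atTop (𝓝 r) := by
      have h2 := (tendsto_const_nhds (x := r)).add (tendsto_one_div_add_atTop_nhds_zero_nat (𝕜 := ℝ))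
      rwa [add_zero] at h2
    exact (continuous_coe_real_ereal.tendsto r).comp h1

theorem isProbabilityMeasure_emp {X : Type*} [MeasurableSpace X] {N : ℕ} (hN : N ≠ 0)
    (x : Fin N → X) : IsProbabilityMeasure (emp N x) :=
  ⟨by
    rw [emp, Measure.smul_apply, Measure.finsetSum_apply]
    simpa using ENNReal.inv_mul_cancel (Nat.cast_ne_zero.2 hN) (ENNReal.natCast_ne_top N)⟩

theorem ae_emp {X : Type*} [MeasurableSpace X] {N : ℕ} {x : Fin N → X} {K : Set X}
    (hK : MeasurableSet K) (hx : ∀ i, x i ∈ K) : ∀ᵐ z ∂emp N x, z ∈ K := by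
  change emp N x Kᶜ = 0
  rw [emp, Measure.smul_apply, Measure.finsetSum_apply]
  simp [hK.compl, hx]

end

/-- **Γ-convergence for unbounded potential energy (Theorem 4.1).**
Under the uniform strict convexity and quadratic growth conditions (ii'), (iii') and for
short times `b − a ≤ √(c₁/(4c₂))`, the functionals `𝔸_{μ_a^{(N)},μ_b^{(N)}}` Γ-converge to
`𝔸_{μ_a,μ_b}` with respect to weak convergence of probability measures. -/
theorem gamma_convergence_unbounded_potential
    {n : ℕ} (hn : 1 ≤ n) {a b : ℝ} (hab : a < b)
    (L : Eu n → Eu n → ℝ)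
    (hL1 : ContDiff ℝ (⊤ : ℕ∞) (Function.uncurry L))
    (c₀ : ℝ) (hc₀ : 0 < c₀)
    (hL2 : ∀ x v w : Eu n, c₀ * ‖w‖ ^ 2 ≤ fderiv ℝ (fderiv ℝ (L x)) v w w)
    (c₁ c₂ : ℝ) (hc₁ : 0 < c₁) (hc₂ : 0 < c₂) (x₀ : Eu n)
    (hL3 : ∀ x v : Eu n, c₁ * ‖v‖ ^ 2 - c₂ * (1 + ‖x - x₀‖ ^ 2) ≤ L x v)
    (htime : b - a ≤ Real.sqrt (c₁ / (4 * c₂)))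
    (μa μb : Measure (Eu n)) [IsProbabilityMeasure μa] [IsProbabilityMeasure μb]
    (hμaC : ∃ K : Set (Eu n), IsCompact K ∧ μa K = 1)
    (hμbC : ∃ K : Set (Eu n), IsCompact K ∧ μb K = 1)
    (hμaAC : μa ≪ volume) (hμbAC : μb ≪ volume)
    (x y : (N : ℕ) → Fin N → Eu n)
    (hxinj : ∀ N, Function.Injective (x N))
    (hsupp : ∃ K : Set (Eu n), IsCompact K ∧ ∀ N i, x N i ∈ K ∧ y N i ∈ K)
    (hxw : WeakLim (fun N => emp N (x N)) μa)
    (hyw : WeakLim (fun N => emp N (y N)) μb) :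
    (∀ (πs : ℕ → Measure (CPath a b n)) (π : Measure (CPath a b n)),
      (∀ N, IsProbabilityMeasure (πs N)) → IsProbabilityMeasure π → WeakLim πs π →
      aFun (action L a b) μa μb π ≤
        liminf (fun N => aFun (action L a b) (emp N (x N)) (emp N (y N)) (πs N)) atTop) ∧
    (∀ π : Measure (CPath a b n), IsProbabilityMeasure π →
      ∃ πs : ℕ → Measure (CPath a b n),
        (∀ N, IsProbabilityMeasure (πs N)) ∧ WeakLim πs π ∧
        Tendsto (fun N => aFun (action L a b) (emp N (x N)) (emp N (y N)) (πs N))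
          atTop (𝓝 (aFun (action L a b) μa μb π))) := by
  have hL := isTonelli_of_hessian_pos hL1 hc₀ hL2 hc₁ hc₂ hL3
  obtain ⟨Ka, hKa, hμKa⟩ := hμaC
  obtain ⟨Kb, hKb, hμKb⟩ := hμbC
  obtain ⟨K, hK, hxyK⟩ := hsupp
  set S : Set (Eu n) := K ∪ (Ka ∪ Kb)
  have hS : IsCompact S := hK.union (hKa.union hKb)
  have hμaS : ∀ᵐ z ∂μa, z ∈ S :=
    Filter.Eventually.mono ((mem_ae_iff_prob_eq_one hKa.measurableSet).2 hμKa) fun z hz => Or.inr (Or.inl hz)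
  have hμbS : ∀ᵐ z ∂μb, z ∈ S :=
    Filter.Eventually.mono ((mem_ae_iff_prob_eq_one hKb.measurableSet).2 hμKb) fun z hz => Or.inr (Or.inr hz)
  have hxS : ∀ N, ∀ᵐ z ∂emp N (x N), z ∈ S := fun N =>
    ae_emp hS.measurableSet fun i => Or.inl (hxyK N i).1
  have hyS : ∀ N, ∀ᵐ z ∂emp N (y N), z ∈ S := fun N =>
    ae_emp hS.measurableSet fun i => Or.inl (hxyK N i).2
  refine ⟨fun πs π _ _ hw => ?_, fun π _ => ?_⟩
  · obtain ⟨R, hR⟩ := hS.isBounded.subset_closedBall x₀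
    have hSR : ∀ z ∈ S, ‖z - x₀‖ ≤ R := fun z hz => by
      rw [← dist_eq_norm]
      exact hR hz
    exact hL.aFun_le_liminf hab htime hxw hyw (hμaS.mono hSR) (fun N => (hxS N).mono hSR) hw
  · set νa : ℕ → Measure (Eu n) := fun N => if N = 0 then μa else emp N (x N) with hνa
    set νb : ℕ → Measure (Eu n) := fun N => if N = 0 then μb else emp N (y N) with hνb
    have hea : ∀ᶠ N in atTop, emp N (x N) = νa N :=
      (eventually_ne_atTop 0).mono fun N hN => (if_neg hN).symm
    have heb : ∀ᶠ N in atTop, emp N (y N) = νb N :=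
      (eventually_ne_atTop 0).mono fun N hN => (if_neg hN).symm
    have hpa : ∀ N, IsProbabilityMeasure (νa N) := fun N => by
      simp only [hνa]
      split_ifs with hN
      · infer_instance
      · exact isProbabilityMeasure_emp hN _
    have hpb : ∀ N, IsProbabilityMeasure (νb N) := fun N => by
      simp only [hνb]
      split_ifs with hN
      · infer_instance
      · exact isProbabilityMeasure_emp hN _
    have hSa : ∀ N, ∀ᵐ z ∂νa N, z ∈ S := fun N => by
      simp only [hνa]
      split_ifs
      · exact hμaS
      · exact hxS N
    have hSb : ∀ N, ∀ᵐ z ∂νb N, z ∈ S := fun N => by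
      simp only [hνb]
      split_ifs
      · exact hμbS
      · exact hyS N
    obtain ⟨πs, hπs, hw, hlim⟩ := hL.exists_recovery_seq hab htime hμaAC hμbAC
      (fun φ => (hxw φ).congr' (hea.mono fun N hN => congrArg (fun ν => ∫ z, φ z ∂ν) hN))
      (fun φ => (hyw φ).congr' (heb.mono fun N hN => congrArg (fun ν => ∫ z, φ z ∂ν) hN)) hS hμaS hSa hSb π
    refine ⟨πs, hπs, hw, hlim.congr' ?_⟩
    filter_upwards [hea, heb] with N h1 h2
    rw [h1, h2]
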